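/- Let n ≥ 1, let U ⊂ ℝ^n be a nonempty open, bounded, connected set, and let u ∈ W^{1,∞}(U,ℝ^n) satisfy diam(u(U)) ≤ d, mult_U(u) ≤ m, and 0 < λ ≤ det Du(x) for a.e. x ∈ U. Then there exists a bounded Lipschitz map s : U → ℝ^n that is measure preserving such that ∫_U |u(x) − (|u(U)|/|U|)^{1/n} s(x)| dx ≤ 5 (m d / λ) · ∫_U | |u(U)|/|U| − 1/ω_u(u(x)) | dx. -/

import Mathlib

open MeasureTheory Metric Set Bornology

noncomputable section

/-- The Jacobian determinant of `u` at `x` (junk value if `u` is not differentiable at `x`). -/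
def detD {n : ℕ} (u : EuclideanSpace ℝ (Fin n) → EuclideanSpace ℝ (Fin n))
    (x : EuclideanSpace ℝ (Fin n)) : ℝ :=
  LinearMap.det ((fderiv ℝ u x).toLinearMap)

/-- `ω_u(y) = Σ_{x ∈ P_u(y)} 1/det Du(x)`, where
`P_u(y) = {x ∈ U : u x = y, u differentiable at x, det Du(x) > 0}`; the sum is taken in
`ℝ≥0∞`, so it is `0` if `P_u(y)` is empty and `∞` if `P_u(y)` is uncountable. -/
def omegaFn {n : ℕ} (U : Set (EuclideanSpace ℝ (Fin n)))
    (u : EuclideanSpace ℝ (Fin n) → EuclideanSpace ℝ (Fin n))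
    (y : EuclideanSpace ℝ (Fin n)) : ENNReal :=
  ∑' x : {x : EuclideanSpace ℝ (Fin n) //
      x ∈ U ∧ u x = y ∧ DifferentiableAt ℝ u x ∧ 0 < detD u x},
    ENNReal.ofReal (detD u x.1)⁻¹

section Shear
variable {ι : Type} [Fintype ι] (p : ι → Prop) [DecidablePred p]

def shearFn (h : ({i // ¬ p i} → ℝ) → ({i // p i} → ℝ)) (x : ι → ℝ) : ι → ℝ :=
  fun i => if hi : p i then x i + h (fun j => x j.1) ⟨i, hi⟩ else x i

lemma shearFn_mp (h : ({i // ¬ p i} → ℝ) → ({i // p i} → ℝ)) (hh : Measurable h) :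
    MeasurePreserving (shearFn p h) volume volume := by
  have e := volume_preserving_piEquivPiSubtypeProd (fun _ : ι => ℝ) p
  have hs : MeasurePreserving (fun q : ({i // ¬ p i} → ℝ) × ({i // p i} → ℝ) =>
      (id q.1, q.2 + h q.1)) (volume.prod volume) (volume.prod volume) := by
    refine MeasurePreserving.skew_product (g := fun a b => b + h a) (MeasurePreserving.id _) ?_ ?_
    · exact measurable_snd.add (hh.comp measurable_fst)
    · refine Filter.Eventually.of_forall fun a => ?_
      exact (measurePreserving_add_right volume (h a)).map_eq
  have hsw := Measure.measurePreserving_swap (μ := (volume : Measure ({i // p i} → ℝ)))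
    (ν := (volume : Measure ({i // ¬ p i} → ℝ)))
  have hsw' := Measure.measurePreserving_swap (μ := (volume : Measure ({i // ¬ p i} → ℝ)))
    (ν := (volume : Measure ({i // p i} → ℝ)))
  have := (e.symm).comp (hsw'.comp (hs.comp (hsw.comp e)))
  have heq : shearFn p h = (MeasurableEquiv.piEquivPiSubtypeProd (fun _ : ι => ℝ) p).symm ∘
      Prod.swap ∘ (fun q : ({i // ¬ p i} → ℝ) × ({i // p i} → ℝ) => (id q.1, q.2 + h q.1)) ∘
      Prod.swap ∘ (MeasurableEquiv.piEquivPiSubtypeProd (fun _ : ι => ℝ) p) := by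
    ext x i
    by_cases hi : p i
    · simp [shearFn, hi, MeasurableEquiv.piEquivPiSubtypeProd, Equiv.piEquivPiSubtypeProd]
    · simp [shearFn, hi, MeasurableEquiv.piEquivPiSubtypeProd, Equiv.piEquivPiSubtypeProd]
  rw [heq]
  exact this

lemma shearFn_inj (h : ({i // ¬ p i} → ℝ) → ({i // p i} → ℝ)) :
    Function.Injective (shearFn p h) := by
  intro x y hxy
  have h1 : (fun j : {i // ¬ p i} => x j.1) = fun j => y j.1 := by
    ext j
    have := congrFun hxy j.1
    simpa [shearFn, j.2] using this
  ext i
  have := congrFun hxy i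
  by_cases hi : p i
  · simpa [shearFn, hi, h1] using this
  · simpa [shearFn, hi] using this

lemma shearFn_lip (h : ({i // ¬ p i} → ℝ) → ({i // p i} → ℝ)) (C : NNReal)
    (hh : LipschitzWith C h) : LipschitzWith (1 + C) (shearFn p h) := by
  refine LipschitzWith.of_dist_le_mul fun x y => ?_
  have hr : dist (fun j : {i // ¬ p i} => x j.1) (fun j => y j.1) ≤ dist x y :=
    (dist_pi_le_iff dist_nonneg).2 fun j => dist_le_pi_dist x y j.1
  have hd := (hh.dist_le_mul (fun j : {i // ¬ p i} => x j.1) (fun j => y j.1)).trans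
    (mul_le_mul_of_nonneg_left hr C.2)
  have h0 : 0 ≤ (C : ℝ) * dist x y := by positivity
  push_cast
  rw [dist_pi_le_iff (by positivity)]
  intro i
  have hi' := dist_le_pi_dist x y i
  by_cases hi : p i
  · simp only [shearFn, hi, dite_true]
    refine (dist_add_add_le _ _ _ _).trans ?_
    have := (dist_le_pi_dist (h (fun j : {i // ¬ p i} => x j.1)) (h (fun j => y j.1)) ⟨i, hi⟩).trans hd
    linarith
  · simp only [shearFn, hi, dite_false]
    linarith

end Shear

/-- cell index -/
def idx {ι : Type} (η : ℝ) (x : ι → ℝ) : ι → ℤ := fun i => ⌊x i / η⌋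

lemma measurable_idx {ι : Type} [Fintype ι] (η : ℝ) : Measurable (idx (ι := ι) η) := by
  refine measurable_pi_lambda _ fun i => ?_
  have h1 : Measurable fun x : ι → ℝ => x i / η := by fun_prop
  exact Int.measurable_floor.comp h1

/-- integer maps which can be realised approximately by Lipschitz measure preserving maps -/
def Good {ι : Type} [Fintype ι] (η : ℝ) (φ : (ι → ℤ) → (ι → ℤ)) : Prop :=
  ∀ S : Set (ι → ℤ), S.Finite → ∃ R : ℝ, ∀ ε : ENNReal, 0 < ε → ∃ (Φ : (ι → ℝ) → (ι → ℝ)) (C : NNReal),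
    LipschitzWith C Φ ∧ MeasurePreserving Φ volume volume ∧ Function.Injective Φ ∧
    (∀ x, dist (Φ x) x ≤ R) ∧
    volume {x | idx η x ∈ S ∧ idx η (Φ x) ≠ φ (idx η x)} ≤ ε

lemma Good.comp {ι : Type} [Fintype ι] {η : ℝ} {φ ψ : (ι → ℤ) → (ι → ℤ)} (hψ : Good η ψ) (hφ : Good η φ) :
    Good η (ψ ∘ φ) := by
  intro S hS
  obtain ⟨R, hR⟩ := hφ S hS
  obtain ⟨R', hR'⟩ := hψ (φ '' S) (hS.image φ)
  refine ⟨R' + R, fun ε hε => ?_⟩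
  obtain ⟨Φ, C, h1, h2, h3, h4, h5⟩ := hR (ε / 2) (ENNReal.half_pos hε.ne')
  obtain ⟨Ψ, C', g1, g2, g3, g4, g5⟩ := hR' (ε / 2) (ENNReal.half_pos hε.ne')
  refine ⟨Ψ ∘ Φ, C' * C, g1.comp h1, g2.comp h2, g3.comp h3, fun x => ?_, ?_⟩
  · exact (dist_triangle _ (Φ x) _).trans (add_le_add (g4 _) (h4 _))
  · have hsub : {x | idx η x ∈ S ∧ idx η ((Ψ ∘ Φ) x) ≠ (ψ ∘ φ) (idx η x)} ⊆
        {x | idx η x ∈ S ∧ idx η (Φ x) ≠ φ (idx η x)} ∪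
        Φ ⁻¹' {x | idx η x ∈ φ '' S ∧ idx η (Ψ x) ≠ ψ (idx η x)} := by
      intro x hx
      by_cases hb : idx η (Φ x) = φ (idx η x)
      · right
        refine ⟨?_, ?_⟩
        · rw [hb]; exact mem_image_of_mem _ hx.1
        · have := hx.2
          simp only [Function.comp] at this
          rwa [hb]
      · left; exact ⟨hx.1, hb⟩
    have hm : MeasurableSet {x | idx η x ∈ φ '' S ∧ idx η (Ψ x) ≠ ψ (idx η x)} := by
      refine MeasurableSet.inter ((measurable_idx η) (hS.image φ).measurableSet) ?_
      refine (measurableSet_eq_fun ((measurable_idx η).comp g2.measurable) ?_).compl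
      exact (measurable_of_countable ψ).comp (measurable_idx η)
    calc _ ≤ _ := measure_mono hsub
      _ ≤ _ := measure_union_le _ _
      _ ≤ ε / 2 + ε / 2 := by
        gcongr
        rw [h2.measure_preimage hm.nullMeasurableSet]
        exact g5
      _ = ε := ENNReal.add_halves ε

lemma idx_eq_iff {ι : Type} {η : ℝ} (hη : 0 < η) (x : ι → ℝ) (k : ι → ℤ) :
    idx η x = k ↔ x ∈ Set.pi univ (fun i => Ico (η * k i) (η * k i + η)) := by
  simp only [idx, funext_iff, Int.floor_eq_iff, Set.mem_pi, mem_univ, true_implies, mem_Ico]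
  refine forall_congr' fun i => ?_
  rw [le_div_iff₀ hη, div_lt_iff₀ hη]
  constructor <;> rintro ⟨h1, h2⟩ <;> constructor <;> nlinarith

lemma volume_cell {ι : Type} [Fintype ι] {η : ℝ} (hη : 0 < η) (k : ι → ℤ) :
    volume {x : ι → ℝ | idx η x = k} = ENNReal.ofReal η ^ Fintype.card ι := by
  have : {x : ι → ℝ | idx η x = k} = Set.pi univ (fun i => Ico (η * k i) (η * k i + η)) := by
    ext x; exact idx_eq_iff hη x k
  rw [this, Real.volume_pi_Ico]
  simp

lemma volume_cells_lt {ι : Type} [Fintype ι] {η : ℝ} (hη : 0 < η) (S : Set (ι → ℤ)) (hS : S.Finite) :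
    volume {x : ι → ℝ | idx η x ∈ S} < ⊤ := by
  have : {x : ι → ℝ | idx η x ∈ S} = ⋃ k ∈ S, {x : ι → ℝ | idx η x = k} := by
    ext x; simp
  rw [this]
  refine measure_biUnion_lt_top hS fun k _ => ?_
  rw [volume_cell hη]
  finiteness

lemma lip_sum {β Y F : Type} [PseudoMetricSpace Y] [NormedAddCommGroup F] [NormedSpace ℝ F]
    (T : Finset β) (f : β → Y → ℝ) (C : NNReal) (hf : ∀ b, LipschitzWith C (f b)) (v : β → F) :
    ∃ D : NNReal, LipschitzWith D (fun y => ∑ b ∈ T, f b y • v b) := by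
  refine ⟨∑ b ∈ T, C * ‖v b‖₊, LipschitzWith.of_dist_le_mul fun x y => ?_⟩
  rw [dist_eq_norm, ← Finset.sum_sub_distrib]
  refine (norm_sum_le _ _).trans ?_
  push_cast
  rw [Finset.sum_mul]
  refine Finset.sum_le_sum fun b _ => ?_
  rw [← sub_smul, norm_smul]
  have := (hf b).dist_le_mul x y
  rw [Real.dist_eq] at this
  rw [Real.norm_eq_abs]
  calc _ ≤ (C * dist x y) * ‖v b‖ := by gcongr
    _ = _ := by ring

section Shear2
variable {ι : Type} [Fintype ι] (p : ι → Prop) [DecidablePred p]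

def intShear (G : ({i // ¬ p i} → ℤ) → ({i // p i} → ℤ)) (x : ι → ℤ) : ι → ℤ :=
  fun i => if hi : p i then x i + G (fun j => x j.1) ⟨i, hi⟩ else x i

def bump {β : Type} [Fintype β] (η ρ : ℝ) (b : β → ℤ) (y : β → ℝ) : ℝ :=
  min (infDist y {z | idx η z = b}ᶜ / ρ) 1

lemma bump_lip {β : Type} [Fintype β] (η ρ : ℝ) (hρ : 0 < ρ) (b : β → ℤ) :
    LipschitzWith (ρ⁻¹).toNNReal (bump η ρ b) := by
  refine LipschitzWith.min_const ?_ 1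
  refine LipschitzWith.of_dist_le_mul fun x y => ?_
  have := (lipschitz_infDist_pt ({z | idx η z = b}ᶜ)).dist_le_mul x y
  rw [Real.coe_toNNReal _ (by positivity), Real.dist_eq, ← sub_div, abs_div, abs_of_pos hρ]
  rw [Real.dist_eq] at this
  rw [div_eq_inv_mul]
  gcongr
  simpa using this

lemma bump_mem {β : Type} [Fintype β] (η ρ : ℝ) (hρ : 0 < ρ) (b : β → ℤ) (y : β → ℝ) :
    0 ≤ bump η ρ b y ∧ bump η ρ b y ≤ 1 :=
  ⟨le_min (div_nonneg infDist_nonneg hρ.le) zero_le_one, min_le_right _ _⟩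

lemma bump_ne {β : Type} [Fintype β] (η ρ : ℝ) (b : β → ℤ) (y : β → ℝ) (h : idx η y ≠ b) :
    bump η ρ b y = 0 := by
  have : infDist y {z | idx η z = b}ᶜ = 0 := infDist_zero_of_mem h
  simp [bump, this]

lemma good_shear [Nonempty {i // ¬ p i}] {η : ℝ} (hη : 0 < η)
    (G : ({i // ¬ p i} → ℤ) → ({i // p i} → ℤ)) : Good η (intShear p G) := by
  classical
  intro S hS
  let rs : (ι → ℤ) → ({i // ¬ p i} → ℤ) := fun k j => k j.1
  let T : Finset ({i // ¬ p i} → ℤ) := (hS.image rs).toFinset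
  let v : ({i // ¬ p i} → ℤ) → ({i // p i} → ℝ) := fun b i => η * G b i
  refine ⟨∑ b ∈ T, ‖v b‖, fun ε hε => ?_⟩
  let A : ℕ → Set (ι → ℝ) := fun j => {x | idx η x ∈ S ∧
    infDist (fun i : {i // ¬ p i} => x i.1) {z | idx η z = rs (idx η x)}ᶜ < 1 / ((j : ℝ) + 1)}
  have hres : Continuous (fun (x : ι → ℝ) (i : {i // ¬ p i}) => x i.1) := by fun_prop
  have hAm : ∀ j, MeasurableSet (A j) := by
    intro j
    have : A j = ⋃ k ∈ S, ({x | idx η x = k} ∩ {x | infDist (fun i : {i // ¬ p i} => x i.1)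
        {z | idx η z = rs k}ᶜ < 1 / ((j : ℝ) + 1)}) := by
      ext x; simp [A]
    rw [this]
    refine MeasurableSet.biUnion hS.countable fun k _ => ?_
    refine (measurable_idx η (measurableSet_singleton k)).inter ?_
    exact measurableSet_lt (((continuous_infDist_pt _).comp hres).measurable) measurable_const
  have hAanti : Antitone A := by
    intro i j hij x hx
    refine ⟨hx.1, hx.2.trans_le ?_⟩
    gcongr
  have hlim : Filter.Tendsto (volume ∘ A) Filter.atTop (nhds (volume (⋂ j, A j))) := by
    refine tendsto_measure_iInter_atTop (fun j => (hAm j).nullMeasurableSet) hAanti ⟨0, ?_⟩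
    refine ((measure_mono fun x hx => ?_).trans_lt (volume_cells_lt hη S hS)).ne
    exact hx.1
  have hnull : volume (⋂ j, A j) = 0 := by
    have hsub : (⋂ j, A j) ⊆ ⋃ (i : ι) (z : ℤ), {x : ι → ℝ | x i = η * z} := by
      intro x hx
      rw [mem_iInter] at hx
      by_contra hcon
      simp only [mem_iUnion, mem_setOf_eq, not_exists] at hcon
      have hpos : 0 < infDist (fun i : {i // ¬ p i} => x i.1) {z | idx η z = rs (idx η x)}ᶜ := by
        have hopen : IsOpen (Set.pi univ (fun i : {i // ¬ p i} =>
            Ioo (η * idx η x i) (η * idx η x i + η))) := isOpen_set_pi finite_univ fun _ _ => isOpen_Ioo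
        have hmem : (fun i : {i // ¬ p i} => x i.1) ∈ (Set.pi univ (fun i : {i // ¬ p i} =>
            Ioo (η * idx η x i) (η * idx η x i + η))) := by
          intro i _
          have := (idx_eq_iff hη x (idx η x)).1 rfl i.1 (mem_univ _)
          exact ⟨lt_of_le_of_ne this.1 (fun h => hcon i.1 _ h.symm), this.2⟩
        have hne : ({z : {i // ¬ p i} → ℝ | idx η z = rs (idx η x)}ᶜ).Nonempty := by
          obtain ⟨i0⟩ := ‹Nonempty {i // ¬ p i}›
          refine ⟨fun i => x i.1 + η, fun h => ?_⟩
          have h1 := congrFun h i0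
          simp only [idx, rs] at h1
          rw [add_div, div_self hη.ne', Int.floor_add_one] at h1
          omega
        obtain ⟨r, hr, hball⟩ := Metric.isOpen_iff.1 hopen _ hmem
        refine hr.trans_le ((le_infDist hne).2 fun z hz => ?_)
        by_contra hlt
        push Not at hlt
        have hz' := hball (show z ∈ ball _ r by rwa [mem_ball, dist_comm])
        apply hz
        refine (idx_eq_iff hη z _).2 fun i hi => ?_
        exact Ioo_subset_Ico_self (hz' i hi)
      obtain ⟨j, hj⟩ := exists_nat_one_div_lt hpos
      exact lt_asymm hj (hx j).2
    refine measure_mono_null hsub ?_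
    simp only [measure_iUnion_null_iff]
    intro i z
    exact Measure.pi_hyperplane _ i _
  rw [hnull] at hlim
  obtain ⟨j, hj⟩ := (hlim.eventually (gt_mem_nhds hε)).exists
  have hρ : (0 : ℝ) < 1 / ((j : ℝ) + 1) := by positivity
  set ρ : ℝ := 1 / ((j : ℝ) + 1) with hρdef
  let h : ({i // ¬ p i} → ℝ) → ({i // p i} → ℝ) := fun y => ∑ b ∈ T, bump η ρ b y • v b
  obtain ⟨D, hD⟩ := lip_sum T (bump η ρ) _ (bump_lip η ρ hρ) v
  refine ⟨shearFn p h, 1 + D, shearFn_lip p h D hD, shearFn_mp p h hD.continuous.measurable,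
    shearFn_inj p h, fun x => ?_, ?_⟩
  · have hR : ∀ y, ‖h y‖ ≤ ∑ b ∈ T, ‖v b‖ := by
      intro y
      refine (norm_sum_le _ _).trans (Finset.sum_le_sum fun b _ => ?_)
      rw [norm_smul, Real.norm_eq_abs, abs_of_nonneg (bump_mem η ρ hρ b y).1]
      exact mul_le_of_le_one_left (norm_nonneg _) (bump_mem η ρ hρ b y).2
    have h0 : 0 ≤ ∑ b ∈ T, ‖v b‖ := (norm_nonneg _).trans (hR 0)
    rw [dist_pi_le_iff h0]
    intro i
    by_cases hi : p i
    · simp only [shearFn, hi, dite_true, dist_self_add_left]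
      exact (norm_le_pi_norm _ _).trans (hR _)
    · simpa [shearFn, hi] using h0
  · refine (measure_mono ?_).trans hj.le
    intro x hx
    refine ⟨hx.1, ?_⟩
    by_contra hge
    push Not at hge
    apply hx.2
    have hb : idx η (fun i : {i // ¬ p i} => x i.1) = rs (idx η x) := rfl
    have hT : rs (idx η x) ∈ T := by
      simp only [T, Set.Finite.mem_toFinset]; exact mem_image_of_mem _ hx.1
    have hval : h (fun i : {i // ¬ p i} => x i.1) = v (rs (idx η x)) := by
      simp only [h]
      rw [Finset.sum_eq_single_of_mem _ hT]
      · have : bump η ρ (rs (idx η x)) (fun i : {i // ¬ p i} => x i.1) = 1 := by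
          rw [bump, min_eq_right]
          rwa [one_le_div hρ]
        rw [this, one_smul]
      · intro b _ hbne
        rw [bump_ne _ _ _ _ (by rw [hb]; exact hbne.symm), zero_smul]
    ext i
    by_cases hi : p i
    · simp only [idx, shearFn, intShear, hi, dite_true, hval, v]
      rw [add_div, mul_div_cancel_left₀ _ hη.ne', Int.floor_add_intCast]
      rfl
    · simp only [idx, shearFn, intShear, hi, dite_false]

end Shear2

lemma exists_move {ι I : Type} [Fintype ι] (p : ι → Prop) [DecidablePred p] (F F' : I → ι → ℤ)
    (h1 : ∀ k i, ¬ p i → F k i = F' k i)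
    (h2 : ∀ k k', (∀ i, ¬ p i → F k i = F k' i) → ∀ i, p i → F' k i - F k i = F' k' i - F k' i) :
    ∃ G, ∀ k, intShear p G (F k) = F' k := by
  classical
  let G : ({i // ¬ p i} → ℤ) → ({i // p i} → ℤ) := fun b =>
    if h : ∃ k, (fun i : {i // ¬ p i} => F k i.1) = b then
      fun i => F' h.choose i.1 - F h.choose i.1 else 0
  refine ⟨G, fun k => ?_⟩
  ext i
  by_cases hi : p i
  · have hex : ∃ k', (fun i : {i // ¬ p i} => F k' i.1) = (fun i : {i // ¬ p i} => F k i.1) := ⟨k, rfl⟩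
    have hc := hex.choose_spec
    have := h2 _ _ (fun i hi => congrFun hc ⟨i, hi⟩) i hi
    simp only [intShear, hi, dite_true, G, hex]
    rw [this]
    ring
  · simp only [intShear, hi, dite_false]
    exact h1 k i hi

lemma good_perm {ι : Type} [Fintype ι] [DecidableEq ι] (i0 i1 : ι) (h01 : i1 ≠ i0) {η : ℝ} (hη : 0 < η)
    (S : Set (ι → ℤ)) (hS : S.Finite) (σ : (ι → ℤ) → (ι → ℤ)) (hσ : InjOn σ S) :
    ∃ φ, Good η φ ∧ EqOn φ σ S := by
  classical
  letI : Encodable (ι → ℤ) := Encodable.ofCountable _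
  let enc : (ι → ℤ) → ℤ := fun k => (Encodable.encode k : ℤ)
  have henc : Function.Injective enc := fun a b h => Encodable.encode_injective (Int.ofNat_inj.1 h)
  let z : (ι → ℤ) → (ι → ℤ) := fun k => Function.update k i0 0
  obtain ⟨L, hL⟩ : ∃ L : ℤ, ∀ k ∈ S ∪ σ '' S, |k i0| < L := by
    obtain ⟨M, hM⟩ := ((hS.union (hS.image σ)).image (fun k : ι → ℤ => |k i0|)).bddAbove
    exact ⟨M + 1, fun k hk => Int.lt_add_one_of_le (hM (mem_image_of_mem _ hk))⟩
  let P : (ι → ℤ) → ℤ := fun k => k i0 + 2 * L * enc (z k)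
  have hz : ∀ k k' : ι → ℤ, (∀ i, i ≠ i0 → k i = k' i) → z k = z k' := by
    intro k k' h
    ext i
    by_cases hi : i = i0
    · subst hi; simp [z]
    · simp [z, hi, h i hi]
  have hP : InjOn P (S ∪ σ '' S) := by
    intro k hk k' hk' h
    have a1 := abs_lt.1 (hL k hk)
    have a2 := abs_lt.1 (hL k' hk')
    simp only [P] at h
    have hee : enc (z k) = enc (z k') := by
      rcases lt_trichotomy (enc (z k)) (enc (z k')) with hlt | heq | hlt
      · exfalso; nlinarith
      · exact heq
      · exfalso; nlinarith
    have hzz := henc hee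
    rw [hee] at h
    ext i
    by_cases hi : i = i0
    · subst hi; linarith
    · have := congrFun hzz i
      simpa [z, hi] using this
  let F1 : S → ι → ℤ := fun k i => if i = i0 then P k.1 else k.1 i
  let F2 : S → ι → ℤ := fun k i => if i = i0 then P k.1 else enc k.1
  let F3 : S → ι → ℤ := fun k i => if i = i0 then P (σ k.1) else enc k.1
  let F4 : S → ι → ℤ := fun k i => if i = i0 then P (σ k.1) else σ k.1 i
  haveI : Nonempty {i // ¬ (i = i0)} := ⟨⟨i1, h01⟩⟩
  haveI : Nonempty {i // ¬ ¬ (i = i0)} := ⟨⟨i0, by simp⟩⟩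
  obtain ⟨G1, hG1⟩ := exists_move (fun i => i = i0) (fun k : S => k.1) F1
    (by intro k i hi; simp [F1, hi]) (by
      intro k k' h i hi
      subst hi
      simp [F1, P, hz k.1 k'.1 h])
  obtain ⟨G2, hG2⟩ := exists_move (fun i => ¬ (i = i0)) F1 F2
    (by intro k i hi; push Not at hi; simp [F1, F2, hi]) (by
      intro k k' h i hi
      have h0 := h i0 (by simp)
      simp only [F1, if_true] at h0
      have : k = k' := Subtype.ext (hP (Or.inl k.2) (Or.inl k'.2) h0)
      rw [this])
  obtain ⟨G3, hG3⟩ := exists_move (fun i => i = i0) F2 F3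
    (by intro k i hi; simp [F2, F3, hi]) (by
      intro k k' h i hi
      have h0 := h i1 h01
      simp only [F2, if_neg h01] at h0
      have : k = k' := Subtype.ext (henc h0)
      rw [this])
  obtain ⟨G4, hG4⟩ := exists_move (fun i => ¬ (i = i0)) F3 F4
    (by intro k i hi; push Not at hi; simp [F3, F4, hi]) (by
      intro k k' h i hi
      have h0 := h i0 (by simp)
      simp only [F3, if_true] at h0
      have : k = k' := Subtype.ext (hσ k.2 k'.2
        (hP (Or.inr (mem_image_of_mem _ k.2)) (Or.inr (mem_image_of_mem _ k'.2)) h0))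
      rw [this])
  obtain ⟨G5, hG5⟩ := exists_move (fun i => i = i0) F4 (fun k : S => σ k.1)
    (by intro k i hi; simp [F4, hi]) (by
      intro k k' h i hi
      have h0 : ∀ i, i ≠ i0 → σ k.1 i = σ k'.1 i := by
        intro i hi
        have := h i hi
        simpa [F4, hi] using this
      subst hi
      simp [F4, P, hz _ _ h0])
  refine ⟨_, (good_shear _ hη G5).comp ((good_shear _ hη G4).comp ((good_shear _ hη G3).comp
    ((good_shear _ hη G2).comp (good_shear _ hη G1)))), fun k hk => ?_⟩
  simp only [Function.comp]
  rw [hG1 ⟨k, hk⟩, hG2, hG3, hG4, hG5]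

abbrev EE (n : ℕ) := EuclideanSpace ℝ (Fin n)

/-- realisation of injections of cells in Euclidean space -/
lemma perm_E {n : ℕ} (hn : 2 ≤ n) {η : ℝ} (hη : 0 < η)
    (S : Set (Fin n → ℤ)) (hS : S.Finite) (σ : (Fin n → ℤ) → (Fin n → ℤ)) (hσ : InjOn σ S) :
    ∃ R : ℝ, ∀ ε : ENNReal, 0 < ε → ∃ (Φ : EE n → EE n) (C : NNReal),
      LipschitzWith C Φ ∧ MeasurePreserving Φ volume volume ∧ Function.Injective Φ ∧
      (∀ x, dist (Φ x) x ≤ R) ∧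
      volume {x : EE n | idx η x ∈ S ∧ idx η (Φ x) ≠ σ (idx η x)} ≤ ε := by
  obtain ⟨φ, hφ, hφσ⟩ := good_perm (⟨0, by omega⟩ : Fin n) ⟨1, by omega⟩ (by simp) hη S hS σ hσ
  obtain ⟨R, hR⟩ := hφ S hS
  have e1 : LipschitzWith 1 (@WithLp.ofLp 2 (Fin n → ℝ)) := PiLp.lipschitzWith_ofLp 2 (fun _ : Fin n => ℝ)
  obtain ⟨c, e2⟩ : ∃ c, LipschitzWith c (@WithLp.toLp 2 (Fin n → ℝ)) :=
    ⟨_, (PiLp.antilipschitzWith_ofLp 2 (fun _ : Fin n => ℝ)).to_rightInverse (fun x => rfl)⟩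
  refine ⟨c * R, fun ε hε => ?_⟩
  obtain ⟨Φ, C, h1, h2, h3, h4, h5⟩ := hR ε hε
  refine ⟨WithLp.toLp 2 ∘ Φ ∘ WithLp.ofLp, c * (C * 1), e2.comp (h1.comp e1), ?_, ?_, fun x => ?_, ?_⟩
  · exact (PiLp.volume_preserving_toLp (Fin n)).comp (h2.comp (PiLp.volume_preserving_ofLp (Fin n)))
  · exact (WithLp.toLp_injective 2).comp (h3.comp (WithLp.ofLp_injective 2))
  · have := e2.dist_le_mul (Φ x.ofLp) x.ofLp
    exact this.trans (mul_le_mul_of_nonneg_left (h4 _) c.2)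
  · have hset : {x : EE n | idx η x ∈ S ∧ idx η ((WithLp.toLp 2 ∘ Φ ∘ WithLp.ofLp) x) ≠ σ (idx η x)} =
      WithLp.ofLp ⁻¹' {x | idx η x ∈ S ∧ idx η (Φ x) ≠ φ (idx η x)} := by
      ext x
      simp only [mem_setOf_eq, mem_preimage, Function.comp]
      refine and_congr_right fun hx => ?_
      rw [hφσ hx]
    rw [hset, (PiLp.volume_preserving_ofLp (Fin n)).measure_preimage]
    · exact h5
    · refine MeasurableSet.nullMeasurableSet ?_
      refine MeasurableSet.inter ((measurable_idx η) hS.measurableSet) ?_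
      refine (measurableSet_eq_fun ((measurable_idx η).comp h2.measurable) ?_).compl
      exact (measurable_of_countable φ).comp (measurable_idx η)

lemma birkhoff_cost {m : Type} [Fintype m] [DecidableEq m] (M : Matrix m m ℝ)
    (hM : M ∈ doublyStochastic ℝ m) (c : m → m → ℝ) :
    ∃ σ : Equiv.Perm m, ∑ i, c i (σ i) ≤ ∑ i, ∑ j, M i j * c i j := by
  obtain ⟨w, hw0, hw1, hwM⟩ := exists_eq_sum_perm_of_mem_doublyStochastic hM
  have hval : ∑ i, ∑ j, M i j * c i j = ∑ σ, w σ * ∑ i, c i (σ i) := by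
    have : ∀ i j, M i j * c i j = ∑ σ : Equiv.Perm m, w σ * (if σ i = j then c i j else 0) := by
      intro i j
      rw [← hwM, Matrix.sum_apply, Finset.sum_mul]
      refine Finset.sum_congr rfl fun σ _ => ?_
      simp only [Matrix.smul_apply, smul_eq_mul, Equiv.Perm.permMatrix, PEquiv.toMatrix_apply,
        Equiv.toPEquiv_apply, Option.mem_def, Option.some.injEq]
      split_ifs <;> simp
    simp_rw [this]
    calc _ = ∑ i, ∑ σ : Equiv.Perm m, ∑ j, w σ * (if σ i = j then c i j else 0) :=
          Finset.sum_congr rfl fun i _ => Finset.sum_comm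
      _ = ∑ i, ∑ σ : Equiv.Perm m, w σ * c i (σ i) := by simp
      _ = _ := by rw [Finset.sum_comm]; simp [Finset.mul_sum]
  by_contra hcon
  push Not at hcon
  have : ∑ σ, w σ * (∑ i, ∑ j, M i j * c i j) < ∑ σ, w σ * ∑ i, c i (σ i) := by
    refine Finset.sum_lt_sum (fun σ _ => mul_le_mul_of_nonneg_left (hcon σ).le (hw0 σ)) ?_
    by_contra h
    push Not at h
    have hz : ∀ σ, w σ = 0 := by
      intro σ
      by_contra hne
      have hp := lt_of_le_of_ne (hw0 σ) (Ne.symm hne)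
      exact absurd (h σ (Finset.mem_univ _)) (not_le.2 (mul_lt_mul_of_pos_left (hcon σ) hp))
    simp [hz] at hw1
  rw [← Finset.sum_mul, hw1, one_mul, ← hval] at this
  exact lt_irrefl _ this

lemma cellsum {α β : Type} [MeasurableSpace α] [MeasurableSpace β] [MeasurableSingletonClass β]
    (μ : Measure α) (g : α → β) (hg : Measurable g) (S : Finset β) (f : α → ENNReal) :
    ∫⁻ x in g ⁻¹' S, f x ∂μ = ∑ k ∈ S, ∫⁻ x in g ⁻¹' {k}, f x ∂μ := by
  have : g ⁻¹' (S : Set β) = ⋃ k ∈ S, g ⁻¹' {k} := by ext x; simp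
  rw [this, lintegral_biUnion_finset]
  · intro a _ b _ hab
    exact Disjoint.preimage g (by simpa using hab)
  · exact fun k _ => hg (measurableSet_singleton k)

def box (n : ℕ) (R : ℝ) : Set (EE n) := {x | ∀ i, -R ≤ x i ∧ x i < R}

def cellsOf (n N : ℕ) : Finset (Fin n → ℤ) := Fintype.piFinset fun _ => Finset.Ico (-N : ℤ) N

lemma idx_mem_cells {n N : ℕ} (hN : 0 < N) {R : ℝ} (hR : 0 < R) (x : EE n) :
    idx (R / N) x ∈ cellsOf n N ↔ x ∈ box n R := by
  have hN' : (0 : ℝ) < N := by exact_mod_cast hN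
  simp only [cellsOf, Fintype.mem_piFinset, Finset.mem_Ico, idx, box]
  refine forall_congr' fun i => ?_
  rw [Int.le_floor, Int.floor_lt, le_div_iff₀ (by positivity), div_lt_iff₀ (by positivity)]
  have e1 : ((-(N : ℤ) : ℤ) : ℝ) * (R / N) = -R := by push_cast; field_simp
  have e2 : (((N : ℤ) : ℤ) : ℝ) * (R / N) = R := by push_cast; field_simp
  rw [e1, e2]

lemma measurable_idxE {n : ℕ} (η : ℝ) : Measurable (fun x : EE n => idx η x) :=
  (measurable_idx η).comp (PiLp.volume_preserving_ofLp (Fin n)).measurable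

lemma volume_cellE {n : ℕ} {η : ℝ} (hη : 0 < η) (k : Fin n → ℤ) :
    volume {x : EE n | idx η x = k} = ENNReal.ofReal (η ^ n) := by
  have : {x : EE n | idx η x = k} = WithLp.ofLp ⁻¹' {x : Fin n → ℝ | idx η x = k} := rfl
  have hm : MeasurableSet {x : Fin n → ℝ | idx η x = k} := measurable_idx η (measurableSet_singleton k)
  rw [this, (PiLp.volume_preserving_ofLp (Fin n)).measure_preimage hm.nullMeasurableSet, volume_cell hη,
    ENNReal.ofReal_pow hη.le]
  simp

def corner (n : ℕ) (η : ℝ) (k : Fin n → ℤ) : EE n := WithLp.toLp 2 (fun i => η * k i)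

lemma exists_corner (n : ℕ) : ∃ c : ℝ, 0 ≤ c ∧ ∀ η : ℝ, 0 < η → ∀ x y : EE n,
    idx η x = idx η y → dist x y ≤ c * η := by
  obtain ⟨c, e2⟩ : ∃ c, LipschitzWith c (@WithLp.toLp 2 (Fin n → ℝ)) :=
    ⟨_, (PiLp.antilipschitzWith_ofLp 2 (fun _ : Fin n => ℝ)).to_rightInverse (fun x => rfl)⟩
  refine ⟨c, c.2, fun η hη x y hxy => ?_⟩
  refine (e2.dist_le_mul x.ofLp y.ofLp).trans (mul_le_mul_of_nonneg_left ?_ c.2)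
  rw [dist_pi_le_iff hη.le]
  intro i
  have h1 := (idx_eq_iff hη x (idx η y)).1 hxy i (mem_univ _)
  have h2 := (idx_eq_iff hη y (idx η y)).1 rfl i (mem_univ _)
  rw [Real.dist_eq, abs_le]
  constructor <;> linarith [h1.1, h1.2, h2.1, h2.2]

lemma idx_corner {n : ℕ} {η : ℝ} (hη : 0 < η) (k : Fin n → ℤ) : idx η (corner n η k) = k := by
  ext i
  simp [idx, corner, mul_div_cancel_left₀ _ hη.ne']

lemma measurableSet_box (n : ℕ) {R : ℝ} (hR : 0 < R) : MeasurableSet (box n R) := by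
  have : box n R = (fun x : EE n => idx (R / (1 : ℕ)) x) ⁻¹' (cellsOf n 1) := by
    ext x; exact (idx_mem_cells one_pos hR x).symm
  rw [this]
  exact measurable_idxE _ (Finset.measurableSet _)

lemma volume_box_lt (n : ℕ) {R : ℝ} (hR : 0 < R) : volume (box n R) < ⊤ := by
  have : box n R = WithLp.ofLp ⁻¹' {x : Fin n → ℝ | idx (R / (1 : ℕ)) x ∈ ((cellsOf n 1 : Finset _) : Set (Fin n → ℤ))} := by
    ext x; exact (idx_mem_cells one_pos hR x).symm
  rw [this, (PiLp.volume_preserving_ofLp (Fin n)).measure_preimage]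
  · exact volume_cells_lt (by simpa using hR) _ (Finset.finite_toSet _)
  · exact (measurable_idx _ (Finset.measurableSet _)).nullMeasurableSet

lemma box_norm_le (n : ℕ) {R : ℝ} (hR : 0 < R) : ∃ B : ℝ, 0 ≤ B ∧ ∀ x ∈ box n R, ‖x‖ ≤ B := by
  obtain ⟨c, e2⟩ : ∃ c, LipschitzWith c (@WithLp.toLp 2 (Fin n → ℝ)) :=
    ⟨_, (PiLp.antilipschitzWith_ofLp 2 (fun _ : Fin n => ℝ)).to_rightInverse (fun x => rfl)⟩
  refine ⟨c * R, by positivity, fun x hx => ?_⟩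
  have := (e2.dist_le_mul x.ofLp 0)
  simp only [WithLp.toLp_ofLp, WithLp.toLp_zero, dist_zero_right] at this
  refine this.trans (mul_le_mul_of_nonneg_left ?_ c.2)
  rw [pi_norm_le_iff_of_nonneg hR.le]
  intro i
  rw [Real.norm_eq_abs, abs_le]
  exact ⟨(hx i).1, (hx i).2.le⟩

open Classical in
def cst {n : ℕ} (U : Set (EE n)) (u : EE n → EE n) (κ η : ℝ) (k l : Fin n → ℤ) : ℝ :=
  if {x : EE n | idx η x = k} ⊆ U then ‖u (corner n η k) - κ • corner n η l‖ else 0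

lemma cst_nonneg {n : ℕ} (U : Set (EE n)) (u : EE n → EE n) (κ η : ℝ) (k l : Fin n → ℤ) :
    0 ≤ cst U u κ η k l := by
  unfold cst; split_ifs <;> positivity

lemma lip_corner {n : ℕ} {u : EE n → EE n} {K : NNReal} (hu : LipschitzWith K u) {κ η c : ℝ}
    (hκ : 0 ≤ κ) (hη : 0 < η) (hc : ∀ η : ℝ, 0 < η → ∀ x y : EE n, idx η x = idx η y → dist x y ≤ c * η)
    (x z : EE n) :
    |‖u (corner n η (idx η x)) - κ • corner n η (idx η z)‖ - ‖u x - κ • z‖| ≤ (K + κ) * c * η := by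
  refine (abs_norm_sub_norm_le _ _).trans ?_
  have e : u (corner n η (idx η x)) - κ • corner n η (idx η z) - (u x - κ • z) =
    (u (corner n η (idx η x)) - u x) - κ • (corner n η (idx η z) - z) := by
    rw [smul_sub]; abel
  rw [e]
  refine (norm_sub_le _ _).trans ?_
  rw [norm_smul, Real.norm_eq_abs, abs_of_nonneg hκ]
  have h1 := hu.dist_le_mul (corner n η (idx η x)) x
  have h2 := hc η hη (corner n η (idx η x)) x (idx_corner hη _)
  have h3 := hc η hη (corner n η (idx η z)) z (idx_corner hη _)
  rw [dist_eq_norm] at h1 h3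
  have h4 : (K : ℝ) * dist (corner n η (idx η x)) x ≤ K * (c * η) := mul_le_mul_of_nonneg_left h2 K.2
  have h5 : κ * ‖corner n η (idx η z) - z‖ ≤ κ * (c * η) := mul_le_mul_of_nonneg_left h3 hκ
  nlinarith

lemma rowsum {n N : ℕ} (hN : 0 < N) {R : ℝ} (hR : 0 < R)
    (γ : Measure (EE n × EE n)) [IsFiniteMeasure γ] (f g : EE n × EE n → EE n) (hf : Measurable f) (hg : Measurable g)
    (h1 : γ.map f = volume.restrict (box n R)) (h2 : γ.map g = volume.restrict (box n R))
    (k : Fin n → ℤ) (hk : k ∈ cellsOf n N) :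
    ∑ l ∈ cellsOf n N, (γ {p | idx (R / N) (f p) = k ∧ idx (R / N) (g p) = l}).toReal = (R / N) ^ n := by
  have hN' : (0 : ℝ) < N := by exact_mod_cast hN
  have hη : 0 < R / N := by positivity
  set η := R / N with hηd
  have hfi : Measurable fun p => idx η (f p) := (measurable_idxE η).comp hf
  have hgi : Measurable fun p => idx η (g p) := (measurable_idxE η).comp hg
  rw [← ENNReal.toReal_sum (fun l _ => measure_ne_top _ _)]
  have hA : MeasurableSet {p | idx η (f p) = k} := hfi (measurableSet_singleton k)
  have e1 : ∑ l ∈ cellsOf n N, γ {p | idx η (f p) = k ∧ idx η (g p) = l} =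
      ∑ l ∈ cellsOf n N, (γ.restrict {p | idx η (f p) = k}) ((fun p => idx η (g p)) ⁻¹' {l}) := by
    refine Finset.sum_congr rfl fun l _ => ?_
    rw [Measure.restrict_apply (hgi (measurableSet_singleton l))]
    congr 1
    ext p; simp [and_comm]
  rw [e1, sum_measure_preimage_singleton _ (fun l _ => hgi (measurableSet_singleton l))]
  have e2 : (γ.restrict {p | idx η (f p) = k}) ((fun p => idx η (g p)) ⁻¹' (cellsOf n N)) =
      (γ.restrict {p | idx η (f p) = k}) univ := by
    refine measure_congr ?_
    have hn : γ (g ⁻¹' (box n R)ᶜ) = 0 := by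
      rw [← Measure.map_apply hg (measurableSet_box n hR).compl, h2,
        Measure.restrict_apply (measurableSet_box n hR).compl]
      simp
    have hae : ∀ᵐ p ∂(γ.restrict {p | idx η (f p) = k}), g p ∈ box n R := by
      refine ae_restrict_of_ae ?_
      rw [ae_iff]; exact hn
    filter_upwards [hae] with p hp
    have hmem : p ∈ (fun p => idx η (g p)) ⁻¹' ((cellsOf n N : Finset _) : Set (Fin n → ℤ)) := by
      exact (idx_mem_cells hN hR (g p)).2 hp
    apply propext
    exact iff_of_true hmem trivial
  rw [e2, Measure.restrict_apply_univ]
  have e3 : {p | idx η (f p) = k} = f ⁻¹' {x | idx η x = k} := rfl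
  have hcm : MeasurableSet {x : EE n | idx η x = k} := measurable_idxE η (measurableSet_singleton k)
  rw [e3, ← Measure.map_apply hf hcm, h1, Measure.restrict_apply hcm]
  have e4 : {x : EE n | idx η x = k} ∩ box n R = {x : EE n | idx η x = k} := by
    refine inter_eq_left.2 fun x hx => ?_
    have hx' : idx η x = k := hx
    rw [← idx_mem_cells hN hR, ← hηd, hx']
    exact hk
  rw [e4, volume_cellE hη, ENNReal.toReal_ofReal (by positivity)]

lemma discrete_choice {n N : ℕ} (hN : 0 < N) {R : ℝ} (hR : 0 < R)
    (γ : Measure (EE n × EE n)) [IsFiniteMeasure γ]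
    (h1 : γ.map Prod.fst = volume.restrict (box n R)) (h2 : γ.map Prod.snd = volume.restrict (box n R))
    (U : Set (EE n)) (hU : MeasurableSet U) {u : EE n → EE n} {K : NNReal} (hu : LipschitzWith K u) {κ c : ℝ}
    (hκ : 0 ≤ κ) (hc0 : 0 ≤ c)
    (hc : ∀ η : ℝ, 0 < η → ∀ x y : EE n, idx η x = idx η y → dist x y ≤ c * η) :
    ∃ σ : (Fin n → ℤ) → (Fin n → ℤ), MapsTo σ (cellsOf n N) (cellsOf n N) ∧ InjOn σ (cellsOf n N) ∧
      ∑ k ∈ cellsOf n N, ENNReal.ofReal ((R / N) ^ n) * ENNReal.ofReal (cst U u κ (R / N) k (σ k)) ≤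
        ∫⁻ p in Prod.fst ⁻¹' U, ENNReal.ofReal ‖u p.1 - κ • p.2‖ ∂γ +
          ENNReal.ofReal ((K + κ) * c * (R / N)) * γ univ := by
  classical
  have hN' : (0 : ℝ) < N := by exact_mod_cast hN
  have hη : 0 < R / N := by positivity
  set η := R / N with hηd
  set v := η ^ n with hv
  have hv0 : 0 < v := by positivity
  let S := cellsOf n N
  let M : Matrix S S ℝ := fun k l => (γ {p | idx η p.1 = k.1 ∧ idx η p.2 = l.1}).toReal / v
  have hM : M ∈ doublyStochastic ℝ S := by
    rw [mem_doublyStochastic_iff_sum]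
    refine ⟨fun k l => by positivity, fun k => ?_, fun l => ?_⟩
    · simp only [M]
      rw [← Finset.sum_div, Finset.sum_coe_sort S (fun l => (γ {p | idx η p.1 = k.1 ∧ idx η p.2 = l}).toReal),
        rowsum hN hR γ Prod.fst Prod.snd measurable_fst measurable_snd h1 h2 k.1 k.2, div_self hv0.ne']
    · simp only [M]
      have := rowsum hN hR γ Prod.snd Prod.fst measurable_snd measurable_fst h2 h1 l.1 l.2
      have hset : ∀ k, {p : EE n × EE n | idx η p.1 = k ∧ idx η p.2 = l.1} =
          {p : EE n × EE n | idx (R / N) p.2 = l.1 ∧ idx (R / N) p.1 = k} := fun k => by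
        ext p; exact and_comm
      simp_rw [← hset] at this
      rw [← Finset.sum_div, Finset.sum_coe_sort S (fun k => (γ {p | idx η p.1 = k ∧ idx η p.2 = l.1}).toReal),
        this, div_self hv0.ne']
  obtain ⟨σ, hσ⟩ := birkhoff_cost M hM (fun k l => cst U u κ η k.1 l.1)
  let τ : (Fin n → ℤ) → (Fin n → ℤ) := fun k => if h : k ∈ S then (σ ⟨k, h⟩).1 else k
  have hτ : ∀ k : S, τ k.1 = (σ k).1 := fun k => by simp [τ]
  refine ⟨τ, fun k hk => ?_, fun k hk k' hk' h => ?_, ?_⟩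
  · have := hτ ⟨k, hk⟩
    simp only at this
    rw [this]; exact (σ _).2
  · have e1 := hτ ⟨k, hk⟩
    have e2 := hτ ⟨k', hk'⟩
    simp only at e1 e2
    rw [e1, e2] at h
    exact congrArg Subtype.val (σ.injective (Subtype.ext h))
  · have hL : ∑ k ∈ S, ENNReal.ofReal v * ENNReal.ofReal (cst U u κ η k (τ k)) =
        ENNReal.ofReal (∑ k : S, v * cst U u κ η k.1 (σ k).1) := by
      rw [ENNReal.ofReal_sum_of_nonneg (fun k _ => mul_nonneg hv0.le (cst_nonneg _ _ _ _ _ _)),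
        ← Finset.sum_coe_sort S]
      refine Finset.sum_congr rfl fun k _ => ?_
      rw [hτ, ENNReal.ofReal_mul hv0.le]
    rw [hL]
    have hle : ∑ k : S, v * cst U u κ η k.1 (σ k).1 ≤ ∑ k : S, ∑ l : S,
        (γ {p | idx η p.1 = k.1 ∧ idx η p.2 = l.1}).toReal * cst U u κ η k.1 l.1 := by
      rw [← Finset.mul_sum]
      refine (mul_le_mul_of_nonneg_left hσ hv0.le).trans (le_of_eq ?_)
      rw [Finset.mul_sum]
      refine Finset.sum_congr rfl fun k _ => ?_
      rw [Finset.mul_sum]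
      refine Finset.sum_congr rfl fun l _ => ?_
      simp only [M]
      field_simp
    refine (ENNReal.ofReal_le_ofReal hle).trans ?_
    have hR2 : ENNReal.ofReal (∑ k : S, ∑ l : S,
        (γ {p | idx η p.1 = k.1 ∧ idx η p.2 = l.1}).toReal * cst U u κ η k.1 l.1) =
        ∑ q ∈ S ×ˢ S, ∫⁻ p in (fun p : EE n × EE n => (idx η p.1, idx η p.2)) ⁻¹' {q},
          ENNReal.ofReal (cst U u κ η (idx η p.1) (idx η p.2)) ∂γ := by
      rw [Finset.sum_coe_sort S (fun k => ∑ l : S,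
        (γ {p | idx η p.1 = k ∧ idx η p.2 = l.1}).toReal * cst U u κ η k l.1)]
      have : ∀ k, ∑ l : S, (γ {p | idx η p.1 = k ∧ idx η p.2 = l.1}).toReal * cst U u κ η k l.1 =
          ∑ l ∈ S, (γ {p | idx η p.1 = k ∧ idx η p.2 = l}).toReal * cst U u κ η k l := fun k =>
        Finset.sum_coe_sort S (fun l => (γ {p | idx η p.1 = k ∧ idx η p.2 = l}).toReal * cst U u κ η k l)
      simp_rw [this]
      rw [← Finset.sum_product', ENNReal.ofReal_sum_of_nonneg
        (fun q _ => mul_nonneg ENNReal.toReal_nonneg (cst_nonneg _ _ _ _ _ _))]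
      refine Finset.sum_congr rfl fun q _ => ?_
      have hqs : (fun p : EE n × EE n => (idx η p.1, idx η p.2)) ⁻¹' {q} =
          {p | idx η p.1 = q.1 ∧ idx η p.2 = q.2} := by ext p; simp [Prod.ext_iff]
      have hqm : MeasurableSet {p : EE n × EE n | idx η p.1 = q.1 ∧ idx η p.2 = q.2} :=
        (((measurable_idxE η).comp measurable_fst) (measurableSet_singleton q.1)).inter
          (((measurable_idxE η).comp measurable_snd) (measurableSet_singleton q.2))
      rw [hqs]
      rw [setLIntegral_congr_fun (g := fun _ => ENNReal.ofReal (cst U u κ η q.1 q.2)) hqm]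
      · rw [setLIntegral_const, ENNReal.ofReal_mul ENNReal.toReal_nonneg,
          ENNReal.ofReal_toReal (measure_ne_top _ _), mul_comm]
      · intro p hp
        simp only
        rw [hp.1, hp.2]
    rw [hR2, ← cellsum γ (fun p : EE n × EE n => (idx η p.1, idx η p.2)) (((measurable_idxE η).comp measurable_fst).prodMk
      ((measurable_idxE η).comp measurable_snd))]
    refine (setLIntegral_le_lintegral _ _).trans ?_
    have hUm : MeasurableSet (Prod.fst ⁻¹' U : Set (EE n × EE n)) := measurable_fst hU
    calc _ ≤ ∫⁻ p, ((Prod.fst ⁻¹' U).indicator (fun p : EE n × EE n => ENNReal.ofReal ‖u p.1 - κ • p.2‖) p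
          + ENNReal.ofReal ((K + κ) * c * η)) ∂γ := by
          refine lintegral_mono fun p => ?_
          by_cases hp : {x : EE n | idx η x = idx η p.1} ⊆ U
          · have hpU : p ∈ (Prod.fst ⁻¹' U : Set (EE n × EE n)) := hp rfl
            simp only [cst, hp, if_true]
            rw [indicator_of_mem hpU, ← ENNReal.ofReal_add (norm_nonneg _) (by positivity)]
            refine ENNReal.ofReal_le_ofReal ?_
            have := (abs_le.1 (lip_corner hu hκ hη hc p.1 p.2)).2
            linarith
          · simp [cst, hp]
      _ = _ := by
          rw [lintegral_add_right _ measurable_const, lintegral_indicator hUm, lintegral_const]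

lemma bdry_tendsto {n : ℕ} {R : ℝ} (hR : 0 < R) (U : Set (EE n)) (hU : IsOpen U) (hUfin : volume U ≠ ⊤) :
    Filter.Tendsto (fun j : ℕ => volume (U ∩ {x | ¬ {y : EE n | idx (R / (j + 1 : ℕ)) y =
      idx (R / (j + 1 : ℕ)) x} ⊆ U})) Filter.atTop (nhds 0) := by
  rw [← measure_empty (μ := (volume : Measure (EE n)))]
  obtain ⟨c, hc0, hc⟩ := exists_corner n
  refine tendsto_measure_of_ae_tendsto_indicator Filter.atTop MeasurableSet.empty ?_
    hU.measurableSet hUfin (Filter.Eventually.of_forall fun j => inter_subset_left) ?_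
  · intro j
    refine hU.measurableSet.inter ?_
    exact measurable_idxE (R / (j + 1 : ℕ)) (MeasurableSet.of_discrete
      (s := {k : Fin n → ℤ | ¬ {y : EE n | idx (R / (j + 1 : ℕ)) y = k} ⊆ U}))
  · refine Filter.Eventually.of_forall fun x => ?_
    by_cases hx : x ∈ U
    · obtain ⟨r, hr, hb⟩ := Metric.isOpen_iff.1 hU x hx
      have hl : Filter.Tendsto (fun j : ℕ => c * (R / (j + 1 : ℕ))) Filter.atTop (nhds 0) := by
        have : Filter.Tendsto (fun j : ℕ => R / (((j + 1 : ℕ)) : ℝ)) Filter.atTop (nhds 0) :=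
          (tendsto_const_div_atTop_nhds_zero_nat R).comp (Filter.tendsto_add_atTop_nat 1)
        simpa using this.const_mul c
      filter_upwards [hl.eventually (gt_mem_nhds hr)] with j hj
      simp only [mem_empty_iff_false, iff_false]
      rintro ⟨_, h2⟩
      refine h2 fun y hy => hb ?_
      rw [mem_ball]
      exact (hc _ (by positivity) y x hy).trans_lt hj
    · exact Filter.Eventually.of_forall fun j => by simp [hx]

theorem realise {n : ℕ} (hn : 2 ≤ n) {R : ℝ} (hR : 0 < R)
    (γ : Measure (EE n × EE n)) [IsFiniteMeasure γ]
    (h1 : γ.map Prod.fst = volume.restrict (box n R)) (h2 : γ.map Prod.snd = volume.restrict (box n R))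
    (U : Set (EE n)) (hU : IsOpen U) (hUbox : U ⊆ box n R)
    {u : EE n → EE n} {K : NNReal} (hu : LipschitzWith K u) {κ : ℝ}
    (hκ : 0 ≤ κ) (ε : ENNReal) (hε : 0 < ε) :
    ∃ (Φ : EE n → EE n) (C : NNReal),
      LipschitzWith C Φ ∧ MeasurePreserving Φ volume volume ∧ Function.Injective Φ ∧
      ∫⁻ x in U, ENNReal.ofReal ‖u x - κ • Φ x‖ ≤
        ∫⁻ p in Prod.fst ⁻¹' U, ENNReal.ofReal ‖u p.1 - κ • p.2‖ ∂γ + ε := by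
  obtain ⟨c, hc0, hc⟩ := exists_corner n
  obtain ⟨B, hB0, hB⟩ := box_norm_le n hR
  have hUm := hU.measurableSet
  have hboxfin := volume_box_lt n hR
  have hUfin : volume U ≠ ⊤ := ((measure_mono hUbox).trans_lt hboxfin).ne
  -- bound for u on the box
  set Mu : ℝ := ‖u 0‖ + K * B with hMu
  have hMu0 : 0 ≤ Mu := by positivity
  have huB : ∀ x ∈ U, ‖u x‖ ≤ Mu := by
    intro x hx
    have := hu.dist_le_mul x 0
    rw [dist_eq_norm, dist_zero_right] at this
    have h3 : (K : ℝ) * ‖x‖ ≤ K * B := mul_le_mul_of_nonneg_left (hB x (hUbox hx)) K.2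
    have h4 := norm_le_norm_add_norm_sub (u 0) (u x)
    rw [norm_sub_rev] at h4
    linarith
  set M0 : ℝ := Mu + κ * B with hM0
  have hM00 : 0 ≤ M0 := by positivity
  have hε4 : 0 < ε / 4 := ENNReal.div_pos hε.ne' (by simp)
  -- choose the scale
  have hlim1 := bdry_tendsto hR U hU hUfin
  have hlim1' : Filter.Tendsto (fun j : ℕ => ENNReal.ofReal M0 * volume (U ∩ {x | ¬ {y : EE n |
      idx (R / (j + 1 : ℕ)) y = idx (R / (j + 1 : ℕ)) x} ⊆ U})) Filter.atTop (nhds 0) := by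
    have := ENNReal.Tendsto.const_mul (a := ENNReal.ofReal M0) hlim1 (Or.inr ENNReal.ofReal_ne_top)
    simpa using this
  have hl : Filter.Tendsto (fun j : ℕ => ENNReal.ofReal ((K + κ) * c * (R / (j + 1 : ℕ)))) Filter.atTop (nhds 0) := by
    have : Filter.Tendsto (fun j : ℕ => R / (((j + 1 : ℕ)) : ℝ)) Filter.atTop (nhds 0) :=
      (tendsto_const_div_atTop_nhds_zero_nat R).comp (Filter.tendsto_add_atTop_nat 1)
    have := ENNReal.tendsto_ofReal (this.const_mul ((K + κ) * c))
    simpa using this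
  have hlγ : Filter.Tendsto (fun j : ℕ => ENNReal.ofReal ((K + κ) * c * (R / (j + 1 : ℕ))) * γ univ)
      Filter.atTop (nhds 0) := by
    have := ENNReal.Tendsto.mul_const hl (Or.inr (measure_ne_top γ univ))
    simpa using this
  have hlU : Filter.Tendsto (fun j : ℕ => ENNReal.ofReal ((K + κ) * c * (R / (j + 1 : ℕ))) * volume U)
      Filter.atTop (nhds 0) := by
    have := ENNReal.Tendsto.mul_const hl (Or.inr hUfin)
    simpa using this
  obtain ⟨j, hj1, hj2, hj3⟩ := ((hlim1'.eventually (gt_mem_nhds hε4)).and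
    ((hlγ.eventually (gt_mem_nhds hε4)).and (hlU.eventually (gt_mem_nhds hε4)))).exists
  have hNpos : 0 < j + 1 := Nat.succ_pos j
  generalize hNd : j + 1 = N at hj1 hj2 hj3 hNpos
  have hN' : (0 : ℝ) < N := by exact_mod_cast hNpos
  obtain ⟨σ, hσm, hσi, hσc⟩ := discrete_choice hNpos hR γ h1 h2 U hUm hu hκ hc0 hc
  have hη : 0 < R / N := by positivity
  have hidx : ∀ x : EE n, idx (R / N) x ∈ cellsOf n N ↔ x ∈ box n R := idx_mem_cells hNpos hR
  set η := R / (N : ℝ) with hηd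
  obtain ⟨R1, hR1⟩ := perm_E hn hη (cellsOf n N) (Finset.finite_toSet _) σ hσi
  have hR10 : 0 ≤ R1 := by
    obtain ⟨Φ, C, -, -, -, h, -⟩ := hR1 1 one_pos
    exact dist_nonneg.trans (h 0)
  set M1 : ℝ := Mu + κ * (B + R1) with hM1
  have hM10 : 0 ≤ M1 := by positivity
  obtain ⟨Φ, C, hL, hMP, hinj, hdisp, hbad⟩ := hR1 (ε / 4 / ENNReal.ofReal (M1 + 1))
    (ENNReal.div_pos hε4.ne' ENNReal.ofReal_ne_top)
  refine ⟨Φ, C, hL, hMP, hinj, ?_⟩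
  set Bad : Set (EE n) := {x : EE n | idx η x ∈ ((cellsOf n N : Finset _) : Set (Fin n → ℤ)) ∧
    idx η (Φ x) ≠ σ (idx η x)} with hBad
  set Bd : Set (EE n) := U ∩ {x | ¬ {y : EE n | idx η y = idx η x} ⊆ U} with hBd
  have hBadm : MeasurableSet Bad := by
    refine MeasurableSet.inter ((measurable_idxE η) (Finset.measurableSet _)) ?_
    refine (measurableSet_eq_fun ((measurable_idxE η).comp hMP.measurable) ?_).compl
    exact (measurable_of_countable σ).comp (measurable_idxE η)
  have hBdm : MeasurableSet Bd := hUm.inter (measurable_idxE η (MeasurableSet.of_discrete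
      (s := {k : Fin n → ℤ | ¬ {y : EE n | idx η y = k} ⊆ U})))
  have hpt : ∀ x ∈ U, ENNReal.ofReal ‖u x - κ • Φ x‖ ≤
      (Bad.indicator (fun _ => ENNReal.ofReal M1) x + Bd.indicator (fun _ => ENNReal.ofReal M0) x) +
      (ENNReal.ofReal ((K + κ) * c * η) + ENNReal.ofReal (cst U u κ η (idx η x) (σ (idx η x)))) := by
    intro x hx
    have hk := (hidx x).2 (hUbox hx)
    have htri : ‖u x - κ • Φ x‖ ≤ Mu + κ * ‖Φ x‖ := by
      refine (norm_sub_le _ _).trans ?_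
      rw [norm_smul, Real.norm_eq_abs, abs_of_nonneg hκ]
      linarith [huB x hx]
    by_cases hxb : x ∈ Bad
    · rw [indicator_of_mem hxb]
      refine le_trans ?_ (le_self_add.trans le_self_add)
      refine ENNReal.ofReal_le_ofReal (htri.trans ?_)
      have h3 := hdisp x
      rw [dist_eq_norm] at h3
      have h4 := norm_le_norm_add_norm_sub x (Φ x)
      rw [norm_sub_rev] at h4
      have : ‖Φ x‖ ≤ B + R1 := by linarith [hB x (hUbox hx)]
      have := mul_le_mul_of_nonneg_left this hκ
      linarith
    · have hgood : idx η (Φ x) = σ (idx η x) := by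
        by_contra h; exact hxb ⟨hk, h⟩
      have hΦbox : Φ x ∈ box n R := by
        rw [← hidx, hgood]; exact hσm hk
      by_cases hxd : x ∈ Bd
      · rw [indicator_of_mem hxd]
        refine le_trans ?_ (le_add_self.trans le_self_add)
        refine ENNReal.ofReal_le_ofReal (htri.trans ?_)
        have := mul_le_mul_of_nonneg_left (hB _ hΦbox) hκ
        linarith
      · have hsub : {y : EE n | idx η y = idx η x} ⊆ U := by
          by_contra h; exact hxd ⟨hx, h⟩
        refine le_trans ?_ le_add_self
        rw [← ENNReal.ofReal_add (by positivity) (cst_nonneg _ _ _ _ _ _)]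
        refine ENNReal.ofReal_le_ofReal ?_
        simp only [cst, hsub, if_true]
        have := (abs_le.1 (lip_corner hu hκ hη hc x (Φ x))).1
        rw [hgood] at this
        linarith
  have hcells : ∫⁻ x in U, ENNReal.ofReal (cst U u κ η (idx η x) (σ (idx η x))) ≤
      ∑ k ∈ cellsOf n N, ENNReal.ofReal (η ^ n) * ENNReal.ofReal (cst U u κ η k (σ k)) := by
    calc _ ≤ ∫⁻ x in (fun x : EE n => idx η x) ⁻¹' (cellsOf n N),
          ENNReal.ofReal (cst U u κ η (idx η x) (σ (idx η x))) :=
          lintegral_mono_set fun x hx => (hidx x).2 (hUbox hx)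
      _ = _ := by
          rw [cellsum _ _ (measurable_idxE η)]
          refine Finset.sum_congr rfl fun k _ => ?_
          have hkm : MeasurableSet ((fun x : EE n => idx η x) ⁻¹' {k}) :=
            measurable_idxE η (measurableSet_singleton k)
          rw [setLIntegral_congr_fun (g := fun _ => ENNReal.ofReal (cst U u κ η k (σ k))) hkm]
          · rw [setLIntegral_const, mul_comm]
            congr 1
            exact volume_cellE hη k
          · intro x hx
            have hx' : idx η x = k := hx
            simp only [hx']
  calc _ ≤ ∫⁻ x in U, ((Bad.indicator (fun _ => ENNReal.ofReal M1) x + Bd.indicator (fun _ => ENNReal.ofReal M0) x) +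
      (ENNReal.ofReal ((K + κ) * c * η) + ENNReal.ofReal (cst U u κ η (idx η x) (σ (idx η x))))) :=
        setLIntegral_mono' hUm hpt
    _ = (∫⁻ x in U, Bad.indicator (fun _ => ENNReal.ofReal M1) x) +
        (∫⁻ x in U, Bd.indicator (fun _ => ENNReal.ofReal M0) x) +
        (ENNReal.ofReal ((K + κ) * c * η) * volume U +
        ∫⁻ x in U, ENNReal.ofReal (cst U u κ η (idx η x) (σ (idx η x)))) := by
        rw [lintegral_add_left, lintegral_add_left, lintegral_add_left, setLIntegral_const]
        · exact measurable_const
        · exact measurable_const.indicator hBadm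
        · exact (measurable_const.indicator hBadm).add (measurable_const.indicator hBdm)
    _ ≤ ε / 4 + ε / 4 + (ε / 4 + (∫⁻ p in Prod.fst ⁻¹' U, ENNReal.ofReal ‖u p.1 - κ • p.2‖ ∂γ + ε / 4)) := by
        gcongr ?_ + ?_ + (?_ + ?_)
        · refine (setLIntegral_le_lintegral _ _).trans ?_
          rw [lintegral_indicator hBadm, setLIntegral_const]
          calc _ ≤ ENNReal.ofReal (M1 + 1) * (ε / 4 / ENNReal.ofReal (M1 + 1)) := by
                gcongr
                linarith
            _ ≤ ε / 4 := ENNReal.mul_div_le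
        · refine (setLIntegral_le_lintegral _ _).trans ?_
          rw [lintegral_indicator hBdm, setLIntegral_const]
          exact hj1.le
        · refine hcells.trans (hσc.trans ?_)
          gcongr
    _ = ∫⁻ p in Prod.fst ⁻¹' U, ENNReal.ofReal ‖u p.1 - κ • p.2‖ ∂γ + (ε / 4 + ε / 4 + ε / 4 + ε / 4) := by ring
    _ = _ := by
        congr 1
        have : ε / 4 + ε / 4 + ε / 4 + ε / 4 = 4 * (ε / 4) := by ring
        rw [this, ENNReal.mul_div_cancel (by norm_num) (by norm_num)]

lemma detD_eq {n : ℕ} (u : EE n → EE n) (x : EE n) : detD u x = (fderiv ℝ u x).det := rfl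

lemma measurable_detD {n : ℕ} (u : EE n → EE n) : Measurable (detD u) := by
  have : Measurable fun x => (fderiv ℝ u x).det :=
    ContinuousLinearMap.continuous_det.measurable.comp (measurable_fderiv ℝ u)
  exact this

def Gset {n : ℕ} (U : Set (EE n)) (u : EE n → EE n) : Set (EE n) :=
  {x | x ∈ U ∧ DifferentiableAt ℝ u x ∧ 0 < detD u x}

lemma measurableSet_Gset {n : ℕ} {U : Set (EE n)} (hU : IsOpen U) (u : EE n → EE n) :
    MeasurableSet (Gset U u) :=
  hU.measurableSet.inter ((measurableSet_of_differentiableAt ℝ u).inter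
    (measurableSet_lt measurable_const (measurable_detD u)))

/-- partition into injectivity pieces -/
lemma exists_pieces {n : ℕ} {U : Set (EE n)} (hU : IsOpen U) (u : EE n → EE n) :
    ∃ G : ℕ → Set (EE n), Pairwise (Function.onFun Disjoint G) ∧ (∀ i, MeasurableSet (G i)) ∧
      (⋃ i, G i) = Gset U u ∧ ∀ i, InjOn u (G i) := by
  classical
  have key : ∀ A : EE n →L[ℝ] EE n, ∃ r : NNReal, r ≠ 0 ∧
      (A.det ≠ 0 → ∀ s, ApproximatesLinearOn u A s r → InjOn u s) := by
    intro A
    by_cases hA : A.det = 0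
    · exact ⟨1, one_ne_zero, fun h => absurd hA h⟩
    · let B := A.toContinuousLinearEquivOfDetNeZero hA
      have hB : (B : EE n →L[ℝ] EE n) = A := by
        ext x; rfl
      rcases B.subsingleton_or_nnnorm_symm_pos with h | h
      · exact ⟨1, one_ne_zero, fun _ s _ x _ y _ _ => Subsingleton.elim x y⟩
      · refine ⟨‖(B.symm : EE n →L[ℝ] EE n)‖₊⁻¹ / 2, ?_, fun _ s hs => ?_⟩
        · have := inv_pos.2 h
          positivity
        · rw [← hB] at hs
          exact hs.injOn (Or.inr (half_lt_self (inv_pos.2 h)))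
  choose r hr0 hr using key
  obtain ⟨t, A, ht1, ht2, ht3, ht4, ht5⟩ :=
    exists_partition_approximatesLinearOn_of_hasFDerivWithinAt u (Gset U u) (fderiv ℝ u)
      (fun x hx => hx.2.1.hasFDerivAt.hasFDerivWithinAt) r hr0
  refine ⟨fun i => Gset U u ∩ t i, ?_, fun i => (measurableSet_Gset hU u).inter (ht2 i), ?_, ?_⟩
  · intro i j hij
    exact (ht1 hij).mono inter_subset_right inter_subset_right
  · rw [← inter_iUnion, inter_eq_left.2 ht3]
  · intro i
    rcases (Gset U u).eq_empty_or_nonempty with h | h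
    · simp [h]
    · obtain ⟨y, hy, hAy⟩ := ht5 h i
      refine hr (A i) ?_ _ (ht4 i)
      rw [hAy]
      exact hy.2.2.ne'

def omegaPiece {n : ℕ} (G : Set (EE n)) (u : EE n → EE n) (y : EE n) : ENNReal :=
  Function.extend (G.domRestrict u) (fun x => ENNReal.ofReal (detD u x)⁻¹) 0 y

lemma omegaPiece_tsum {n : ℕ} {G : Set (EE n)} {u : EE n → EE n} (hG : InjOn u G) (y : EE n) :
    ∑' x, (G ∩ u ⁻¹' {y}).indicator (fun x => ENNReal.ofReal (detD u x)⁻¹) x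
      = omegaPiece G u y := by
  classical
  have hinj : Function.Injective (G.domRestrict u) := injOn_iff_injective.1 hG
  by_cases h : ∃ x : G, G.domRestrict u x = y
  · obtain ⟨x, rfl⟩ := h
    rw [omegaPiece, hinj.extend_apply, tsum_eq_single x.1]
    · rw [indicator_of_mem]
      exact ⟨x.2, rfl⟩
    · intro z hz
      rw [indicator_of_notMem]
      rintro ⟨h1, h2⟩
      exact hz (hG h1 x.2 h2)
  · rw [omegaPiece, Function.extend_apply' _ _ _ h]
    have : G ∩ u ⁻¹' {y} = ∅ := by
      ext z
      simp only [mem_inter_iff, mem_preimage, mem_singleton_iff, mem_empty_iff_false, iff_false]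
      rintro ⟨h1, h2⟩
      exact h ⟨⟨z, h1⟩, h2⟩
    simp [this]

lemma omegaFn_eq {n : ℕ} (U : Set (EE n)) (u : EE n → EE n) {G : ℕ → Set (EE n)}
    (hd : Pairwise (Function.onFun Disjoint G)) (hU : (⋃ i, G i) = Gset U u)
    (hi : ∀ i, InjOn u (G i)) (y : EE n) :
    omegaFn U u y = ∑' i, omegaPiece (G i) u y := by
  classical
  have h1 : omegaFn U u y = ∑' x, (Gset U u ∩ u ⁻¹' {y}).indicator
      (fun x => ENNReal.ofReal (detD u x)⁻¹) x := by
    rw [← tsum_subtype]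
    have : Gset U u ∩ u ⁻¹' {y} = {x | x ∈ U ∧ u x = y ∧ DifferentiableAt ℝ u x ∧ 0 < detD u x} := by
      ext x
      simp only [Gset, mem_inter_iff, mem_preimage, mem_singleton_iff, mem_ofPred_eq]
      tauto
    rw [this]
    rfl
  rw [h1]
  simp_rw [← omegaPiece_tsum (hi _) y]
  rw [ENNReal.tsum_comm]
  congr 1
  ext x
  by_cases hx : x ∈ Gset U u ∩ u ⁻¹' {y}
  · have hx' := hx
    rw [← hU] at hx'
    obtain ⟨i, hxi⟩ := mem_iUnion.1 hx'.1
    rw [tsum_eq_single i, indicator_of_mem hx, indicator_of_mem (show x ∈ G i ∩ u ⁻¹' {y} from ⟨hxi, hx.2⟩)]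
    intro j hj
    rw [indicator_of_notMem]
    exact fun h => disjoint_left.1 (hd hj) h.1 hxi
  · rw [indicator_of_notMem hx]
    symm
    rw [ENNReal.tsum_eq_zero]
    intro i
    rw [indicator_of_notMem]
    intro h
    apply hx
    rw [← hU]
    exact ⟨mem_iUnion.2 ⟨i, h.1⟩, h.2⟩

lemma measurable_omegaPiece {n : ℕ} {G U : Set (EE n)} {u : EE n → EE n} (hm : MeasurableSet G)
    (hGU : G ⊆ Gset U u) (hG : InjOn u G) : Measurable (omegaPiece G u) := by
  have := measurableEmbedding_of_fderivWithin hm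
    (fun x hx => (hGU hx).2.1.hasFDerivAt.hasFDerivWithinAt) hG
  exact this.measurable_extend
    (((measurable_detD u).comp measurable_subtype_coe).inv.ennreal_ofReal) measurable_const

lemma measurable_omegaFn {n : ℕ} {U : Set (EE n)} (hU : IsOpen U) (u : EE n → EE n) :
    Measurable (omegaFn U u) := by
  obtain ⟨G, h1, h2, h3, h4⟩ := exists_pieces hU u
  have : omegaFn U u = fun y => ∑' i, omegaPiece (G i) u y := by
    ext y; exact omegaFn_eq U u h1 h3 h4 y
  rw [this]
  exact Measurable.tsum fun i => measurable_omegaPiece (h2 i)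
    (by rw [← h3]; exact subset_iUnion G i) (h4 i)

/-- area formula -/
theorem area_formula {n : ℕ} {U : Set (EE n)} (hU : IsOpen U) (u : EE n → EE n)
    (hae : ∀ᵐ x ∂(volume.restrict U), x ∈ Gset U u)
    {h : EE n → ENNReal} (hh : Measurable h) :
    ∫⁻ x in U, h (u x) = ∫⁻ y, h y * omegaFn U u y := by
  obtain ⟨G, h1, h2, h3, h4⟩ := exists_pieces hU u
  have hsub : ∀ i, G i ⊆ Gset U u := fun i => by rw [← h3]; exact subset_iUnion G i
  have hGU : Gset U u ⊆ U := fun x hx => hx.1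
  have e1 : ∫⁻ x in U, h (u x) = ∫⁻ x in Gset U u, h (u x) := by
    have : volume.restrict U = volume.restrict (Gset U u) := by
      rw [← Measure.restrict_eq_self_of_ae_mem hae,
        Measure.restrict_restrict (measurableSet_Gset hU u), inter_eq_left.2 hGU]
    rw [this]
  rw [e1, ← h3, lintegral_iUnion h2 h1]
  have hpm := fun i => measurable_omegaPiece (h2 i) (hsub i) (h4 i)
  simp_rw [omegaFn_eq U u h1 h3 h4, ← ENNReal.tsum_mul_left]
  rw [lintegral_tsum (f := fun i y => h y * omegaPiece (G i) u y)
    (fun i => (hh.mul (hpm i)).aemeasurable)]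
  congr 1
  ext i
  have hfd : ∀ x ∈ G i, HasFDerivWithinAt u (fderiv ℝ u x) (G i) x :=
    fun x hx => ((hsub i) hx).2.1.hasFDerivAt.hasFDerivWithinAt
  have him : MeasurableSet (u '' G i) := measurable_image_of_fderivWithin (h2 i) hfd (h4 i)
  have e2 : ∫⁻ y, h y * omegaPiece (G i) u y = ∫⁻ y in u '' G i, h y * omegaPiece (G i) u y := by
    rw [← lintegral_indicator him]
    congr 1
    ext y
    by_cases hy : y ∈ u '' G i
    · rw [indicator_of_mem hy]
    · rw [indicator_of_notMem hy, omegaPiece, Function.extend_apply', Pi.zero_apply, mul_zero]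
      rintro ⟨x, hx⟩
      exact hy ⟨x, x.2, hx⟩
  rw [e2, lintegral_image_eq_lintegral_abs_det_fderiv_mul volume (h2 i) hfd (h4 i)]
  refine setLIntegral_congr_fun (h2 i) fun x hx => ?_
  have hpos : 0 < detD u x := ((hsub i) hx).2.2
  have hval : omegaPiece (G i) u (u x) = ENNReal.ofReal (detD u x)⁻¹ :=
    (injOn_iff_injective.1 (h4 i)).extend_apply _ _ (⟨x, hx⟩ : G i)
  simp only [hval]
  rw [← detD_eq, abs_of_pos hpos, mul_left_comm, ← ENNReal.ofReal_mul hpos.le,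
    mul_inv_cancel₀ hpos.ne', ENNReal.ofReal_one, mul_one]

lemma volume_image_null {n : ℕ} {u : EE n → EE n} {K : NNReal} (hu : LipschitzWith K u)
    {N : Set (EE n)} (hN : volume N = 0) : volume (u '' N) = 0 := by
  have h1 : (volume : Measure (EE n)) ≪ Measure.hausdorffMeasure (Module.finrank ℝ (EE n)) :=
    Measure.absolutelyContinuous_isAddHaarMeasure _ _
  have h2 : (Measure.hausdorffMeasure (Module.finrank ℝ (EE n)) : Measure (EE n)) ≪ volume :=
    Measure.absolutelyContinuous_isAddHaarMeasure _ _
  apply h1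
  have h3 := hu.hausdorffMeasure_image_le (d := Module.finrank ℝ (EE n)) (by positivity) N
  rw [h2 hN, mul_zero] at h3
  exact le_antisymm h3 zero_le

lemma measurableSet_image {n : ℕ} {u : EE n → EE n} (hu : Continuous u)
    {U : Set (EE n)} (hU : IsOpen U) : MeasurableSet (u '' U) := by
  obtain ⟨F, hF1, hF2, hF3, -⟩ := hU.exists_iUnion_isClosed
  have : u '' U = ⋃ k, ⋃ j : ℕ, u '' (F k ∩ closedBall 0 j) := by
    rw [← hF3, image_iUnion]
    congr 1
    ext1 k
    rw [← image_iUnion, ← inter_iUnion, iUnion_closedBall_nat, inter_univ]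
  rw [this]
  refine MeasurableSet.iUnion fun k => MeasurableSet.iUnion fun j => ?_
  exact (((isCompact_closedBall 0 (j : ℝ)).inter_left (hF1 k)).image hu).isClosed.measurableSet

lemma omegaFn_off {n : ℕ} {U : Set (EE n)} {u : EE n → EE n} {y : EE n} (hy : y ∉ u '' U) :
    omegaFn U u y = 0 := by
  unfold omegaFn
  rw [ENNReal.tsum_eq_zero]
  rintro ⟨x, h1, h2, -⟩
  exact absurd ⟨x, h1, h2⟩ hy

lemma omegaFn_pos {n : ℕ} {U : Set (EE n)} {u : EE n → EE n} {x : EE n} (hx : x ∈ Gset U u) :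
    0 < omegaFn U u (u x) := by
  unfold omegaFn
  refine lt_of_lt_of_le ?_ (ENNReal.le_tsum ⟨x, hx.1, rfl, hx.2⟩)
  simpa using hx.2.2

section
variable {n : ℕ} {U : Set (EE n)} {u : EE n → EE n} {K : NNReal} {m : ℕ} {lam : ℝ}

lemma ae_Gset (hlam : 0 < lam)
    (hdet : ∀ᵐ x ∂(volume.restrict U), DifferentiableAt ℝ u x ∧ lam ≤ detD u x) (hUo : IsOpen U) :
    ∀ᵐ x ∂(volume.restrict U), x ∈ Gset U u := by
  filter_upwards [hdet, ae_restrict_mem hUo.measurableSet] with x hx hxU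
  exact ⟨hxU, hx.1, hlam.trans_le hx.2⟩

lemma ae_target (hu : LipschitzWith K u) (hlam : 0 < lam)
    (hdet : ∀ᵐ x ∂(volume.restrict U), DifferentiableAt ℝ u x ∧ lam ≤ detD u x) (hUo : IsOpen U)
    (hm : essSup (fun y => (U ∩ u ⁻¹' {y}).encard) volume ≤ (m : ℕ∞)) :
    ∀ᵐ y : EE n, omegaFn U u y ≤ ENNReal.ofReal (m / lam) ∧ (y ∈ u '' U → 0 < omegaFn U u y) := by
  have hN : volume (u '' {x | x ∈ U ∧ ¬ (DifferentiableAt ℝ u x ∧ lam ≤ detD u x)}) = 0 := by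
    apply volume_image_null hu
    rw [ae_restrict_iff' hUo.measurableSet] at hdet
    rw [← nonpos_iff_eq_zero]
    refine (measure_mono ?_).trans (le_of_eq hdet)
    rintro x ⟨h1, h2⟩ h3
    exact h2 (h3 h1)
  have hae : ∀ᵐ y : EE n, (U ∩ u ⁻¹' {y}).encard ≤ (m : ℕ∞) := by
    filter_upwards [ae_le_essSup (μ := (volume : Measure (EE n)))
      (f := fun y => (U ∩ u ⁻¹' {y}).encard)] with y hy
    exact hy.trans hm
  filter_upwards [hae, measure_eq_zero_iff_ae_notMem.1 hN] with y hy1 hy2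
  have hgood : ∀ x ∈ U, u x = y → DifferentiableAt ℝ u x ∧ lam ≤ detD u x := by
    intro x hx hxy
    by_contra h
    exact hy2 ⟨x, ⟨hx, h⟩, hxy⟩
  constructor
  · have h1 : omegaFn U u y ≤ ∑' x : {x | x ∈ U ∧ u x = y ∧ DifferentiableAt ℝ u x ∧ 0 < detD u x},
        ENNReal.ofReal lam⁻¹ := by
      unfold omegaFn
      refine ENNReal.tsum_le_tsum fun x => ENNReal.ofReal_le_ofReal ?_
      exact inv_anti₀ hlam (hgood x.1 x.2.1 x.2.2.1).2
    refine h1.trans ?_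
    rw [ENNReal.tsum_set_const, div_eq_mul_inv, ENNReal.ofReal_mul (by positivity),
      ENNReal.ofReal_natCast]
    gcongr
    have : ({x | x ∈ U ∧ u x = y ∧ DifferentiableAt ℝ u x ∧ 0 < detD u x}).encard ≤ (m : ℕ∞) :=
      (encard_le_encard (t := U ∩ u ⁻¹' {y}) (fun x hx => ⟨hx.1, hx.2.1⟩)).trans hy1
    exact_mod_cast this
  · rintro ⟨x, hx, rfl⟩
    have := hgood x hx rfl
    exact omegaFn_pos ⟨hx, this.1, hlam.trans_le this.2⟩

lemma volume_le (hu : LipschitzWith K u) (hlam : 0 < lam)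
    (hdet : ∀ᵐ x ∂(volume.restrict U), DifferentiableAt ℝ u x ∧ lam ≤ detD u x) (hUo : IsOpen U)
    (hm : essSup (fun y => (U ∩ u ⁻¹' {y}).encard) volume ≤ (m : ℕ∞)) :
    volume U ≤ ENNReal.ofReal (m / lam) * volume (u '' U) := by
  have h := area_formula hUo u (ae_Gset hlam hdet hUo) (h := fun _ => 1) measurable_const
  rw [setLIntegral_const, one_mul] at h
  rw [h]
  calc _ ≤ ∫⁻ y, (u '' U).indicator (fun _ => ENNReal.ofReal (m / lam)) y := by
        refine lintegral_mono_ae ?_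
        filter_upwards [ae_target hu hlam hdet hUo hm] with y hy
        by_cases hyU : y ∈ u '' U
        · rw [indicator_of_mem hyU, one_mul]; exact hy.1
        · rw [omegaFn_off hyU]; simp
    _ = _ := by
        rw [lintegral_indicator (measurableSet_image hu.continuous hUo), setLIntegral_const]

lemma lintegral_inv_omega (hu : LipschitzWith K u) (hlam : 0 < lam)
    (hdet : ∀ᵐ x ∂(volume.restrict U), DifferentiableAt ℝ u x ∧ lam ≤ detD u x) (hUo : IsOpen U)
    (hm : essSup (fun y => (U ∩ u ⁻¹' {y}).encard) volume ≤ (m : ℕ∞)) :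
    ∫⁻ x in U, (omegaFn U u (u x))⁻¹ = volume (u '' U) := by
  rw [area_formula hUo u (ae_Gset hlam hdet hUo) (h := fun y => (omegaFn U u y)⁻¹)
    (measurable_omegaFn hUo u).inv]
  rw [← lintegral_indicator_one (measurableSet_image hu.continuous hUo)]
  refine lintegral_congr_ae ?_
  filter_upwards [ae_target hu hlam hdet hUo hm] with y hy
  by_cases hyU : y ∈ u '' U
  · rw [indicator_of_mem hyU, Pi.one_apply]
    exact ENNReal.inv_mul_cancel (hy.2 hyU).ne' (ne_top_of_le_ne_top ENNReal.ofReal_ne_top hy.1)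
  · rw [omegaFn_off hyU, indicator_of_notMem hyU, mul_zero]

end

/-- normalised product of two measures -/
def avg {E : Type*} [MeasurableSpace E] (μ ν : Measure E) : Measure (E × E) :=
  (μ univ)⁻¹ • μ.prod ν

lemma avg_fst {E : Type*} [MeasurableSpace E] (μ ν : Measure E) [IsFiniteMeasure μ]
    [IsFiniteMeasure ν] (h : μ univ = ν univ) : (avg μ ν).map Prod.fst = μ := by
  rw [avg, Measure.map_smul, Measure.map_fst_prod, smul_smul, ← h]
  by_cases h0 : μ univ = 0
  · rw [Measure.measure_univ_eq_zero] at h0; simp [h0]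
  · rw [ENNReal.inv_mul_cancel h0 (measure_ne_top _ _), one_smul]

lemma avg_snd {E : Type*} [MeasurableSpace E] (μ ν : Measure E) [IsFiniteMeasure μ]
    [IsFiniteMeasure ν] (h : μ univ = ν univ) : (avg μ ν).map Prod.snd = ν := by
  rw [avg, Measure.map_smul, Measure.map_snd_prod, smul_smul]
  by_cases h0 : μ univ = 0
  · have h1 := h0
    rw [h, Measure.measure_univ_eq_zero] at h1; simp [h1]
  · rw [ENNReal.inv_mul_cancel h0 (measure_ne_top _ _), one_smul]

def thetaFn {n : ℕ} (U : Set (EE n)) (u : EE n → EE n) (c : ENNReal) (y : EE n) : ENNReal :=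
  min 1 (c * omegaFn U u y)⁻¹

lemma measurable_thetaFn {n : ℕ} {U : Set (EE n)} (hU : IsOpen U) (u : EE n → EE n) (c : ENNReal) :
    Measurable (thetaFn U u c) :=
  measurable_const.min (((measurable_omegaFn hU u).const_mul c).inv)

section
variable {n : ℕ} {U : Set (EE n)} {u : EE n → EE n} {K : NNReal}

lemma volume_smul_inter {κ : ℝ} (hκ : 0 < κ) (S A : Set (EE n)) :
    volume (((fun y => κ⁻¹ • y) '' S) ∩ A)
      = (ENNReal.ofReal (κ ^ n))⁻¹ * volume (S ∩ (fun y => κ⁻¹ • y) ⁻¹' A) := by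
  rw [← image_inter_preimage]
  have : volume ((fun y => κ⁻¹ • y) '' (S ∩ (fun y => κ⁻¹ • y) ⁻¹' A)) =
      ENNReal.ofReal |κ⁻¹ ^ Module.finrank ℝ (EE n)| * volume (S ∩ (fun y => κ⁻¹ • y) ⁻¹' A) :=
    Measure.addHaar_smul (volume : Measure (EE n)) κ⁻¹ (S ∩ (fun y => κ⁻¹ • y) ⁻¹' A)
  rw [this, finrank_euclideanSpace_fin, abs_of_pos (by positivity), inv_pow,
    ENNReal.ofReal_inv_of_pos (by positivity)]

lemma map_le (hUo : IsOpen U) (hu : Continuous u)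
    (hae : ∀ᵐ x ∂(volume.restrict U), x ∈ Gset U u) {κ : ℝ} (hκ : 0 < κ) :
    (((volume.restrict U).withDensity
      (fun x => thetaFn U u (ENNReal.ofReal (κ ^ n)) (u x))).map (fun x => κ⁻¹ • u x))
      ≤ volume.restrict ((fun x => κ⁻¹ • u x) '' U) := by
  set c := ENNReal.ofReal (κ ^ n) with hc
  have hT : Continuous (fun x => κ⁻¹ • u x) := by fun_prop
  have hθ := measurable_thetaFn hUo u c
  refine Measure.le_iff.2 fun A hA => ?_
  have hA' : MeasurableSet ((fun y : EE n => κ⁻¹ • y) ⁻¹' A) :=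
    (continuous_const_smul κ⁻¹).measurable hA
  rw [Measure.map_apply hT.measurable hA, withDensity_apply _ (hT.measurable hA),
    Measure.restrict_apply hA, inter_comm A]
  have e : (fun x => κ⁻¹ • u x) '' U = (fun y => κ⁻¹ • y) '' (u '' U) := by
    rw [image_image]
  rw [e, volume_smul_inter hκ, ← lintegral_indicator (hT.measurable hA)]
  have := area_formula hUo u hae
    (h := ((fun y : EE n => κ⁻¹ • y) ⁻¹' A).indicator (thetaFn U u c)) (hθ.indicator hA')
  have e2 : ∀ x, ((fun x => κ⁻¹ • u x) ⁻¹' A).indicator (fun x => thetaFn U u c (u x)) x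
    = ((fun y : EE n => κ⁻¹ • y) ⁻¹' A).indicator (thetaFn U u c) (u x) := fun x => rfl
  simp_rw [e2]
  rw [this, ← hc]
  have hc0 : c ≠ 0 := by rw [hc]; simp; positivity
  have hct : c ≠ ⊤ := ENNReal.ofReal_ne_top
  calc _ ≤ ∫⁻ y, (u '' U ∩ (fun y => κ⁻¹ • y) ⁻¹' A).indicator (fun _ => c⁻¹) y := by
        refine lintegral_mono fun y => ?_
        by_cases hy : y ∈ u '' U
        · by_cases hyA : y ∈ (fun y : EE n => κ⁻¹ • y) ⁻¹' A
          · rw [indicator_of_mem hyA, indicator_of_mem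
              (show y ∈ u '' U ∩ (fun y => κ⁻¹ • y) ⁻¹' A from ⟨hy, hyA⟩)]
            calc _ ≤ (c * omegaFn U u y)⁻¹ * omegaFn U u y := by
                  gcongr; exact min_le_right _ _
              _ = c⁻¹ * ((omegaFn U u y)⁻¹ * omegaFn U u y) := by
                  rw [ENNReal.mul_inv (Or.inl hc0) (Or.inl hct), mul_assoc]
              _ ≤ c⁻¹ * 1 := by
                  gcongr; exact ENNReal.inv_mul_le_one _
              _ = _ := mul_one _
          · rw [indicator_of_notMem hyA]; simp
        · rw [omegaFn_off hy]; simp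
    _ = _ := by
        rw [lintegral_indicator ((measurableSet_image hu hUo).inter hA'), setLIntegral_const]

lemma theta_bound {c w : ENNReal} (hc0 : c ≠ 0) (hct : c ≠ ⊤) (hw : w ≠ 0) :
    c * (1 - min 1 (c * w)⁻¹) ≤ ENNReal.ofReal |c.toReal - (w⁻¹).toReal| := by
  have hw' : w⁻¹ ≠ ⊤ := ENNReal.inv_ne_top.2 hw
  have e : c * (c * w)⁻¹ = w⁻¹ := by
    rw [ENNReal.mul_inv (Or.inl hc0) (Or.inl hct), ← mul_assoc, ENNReal.mul_inv_cancel hc0 hct,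
      one_mul]
  rw [ENNReal.mul_sub (fun _ _ => hct), mul_one]
  have e3 : c * min 1 (c * w)⁻¹ = min c w⁻¹ := by
    rcases le_total 1 (c * w)⁻¹ with h | h
    · rw [min_eq_left h, mul_one, min_eq_left]
      calc c = c * 1 := (mul_one _).symm
        _ ≤ c * (c * w)⁻¹ := by gcongr
        _ = _ := e
    · rw [min_eq_right h, e, min_eq_right]
      calc w⁻¹ = c * (c * w)⁻¹ := e.symm
        _ ≤ c * 1 := by gcongr
        _ = c := mul_one _
  rw [e3]
  rcases le_total c w⁻¹ with h | h
  · rw [min_eq_left h]; simp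
  · rw [min_eq_right h]
    conv_lhs => rw [← ENNReal.ofReal_toReal hct, ← ENNReal.ofReal_toReal hw']
    rw [← ENNReal.ofReal_sub _ ENNReal.toReal_nonneg]
    exact ENNReal.ofReal_le_ofReal (le_abs_self _)

theorem coupling (hn : 2 ≤ n) (hUo : IsOpen U) (hUb : IsBounded U) (hu : LipschitzWith K u)
    (hub : IsBounded (u '' U)) {d : ℝ} (hd : diam (u '' U) ≤ d)
    (hae : ∀ᵐ x ∂(volume.restrict U), x ∈ Gset U u) {κ : ℝ} (hκ : 0 < κ)
    (hvol : volume (u '' U) = ENNReal.ofReal (κ ^ n) * volume U) (ε : ENNReal) (hε : 0 < ε) :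
    ∃ (Φ : EE n → EE n) (C : NNReal), LipschitzWith C Φ ∧ MeasurePreserving Φ volume volume ∧
      Function.Injective Φ ∧ ∫⁻ x in U, ENNReal.ofReal ‖u x - κ • Φ x‖ ≤
        ENNReal.ofReal d * (∫⁻ x in U, (1 - thetaFn U u (ENNReal.ofReal (κ ^ n)) (u x))) + ε := by
  set c := ENNReal.ofReal (κ ^ n) with hc
  have hc0 : c ≠ 0 := by rw [hc]; simp; positivity
  have hct : c ≠ ⊤ := ENNReal.ofReal_ne_top
  set T : EE n → EE n := fun x => κ⁻¹ • u x with hTdef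
  have hT : Continuous T := by have := hu.continuous; fun_prop
  set V := T '' U with hV
  have eV : V = (fun y => κ⁻¹ • y) '' (u '' U) := by rw [image_image]
  have hVm : MeasurableSet V := measurableSet_image hT hUo
  have hVvol : volume V = volume U := by
    have := volume_smul_inter hκ (u '' U) univ
    rw [inter_univ, preimage_univ, inter_univ, ← eV, hvol, ← hc, ← mul_assoc,
      ENNReal.inv_mul_cancel hc0 hct, one_mul] at this
    exact this
  have hUfin : volume U ≠ ⊤ := hUb.measure_lt_top.ne
  -- the box
  have hVb : IsBounded V := by
    rw [eV]
    exact hub.smul₀ κ⁻¹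
  obtain ⟨R0, hR0⟩ := (hUb.union hVb).subset_closedBall (0 : EE n)
  set R := max R0 0 + 1 with hRdef
  have hR : 0 < R := by positivity
  have hsub : U ∪ V ⊆ box n R := by
    intro x hx i
    have h1 : ‖x‖ ≤ R0 := by simpa using hR0 hx
    have h2 : |x i| ≤ ‖x‖ := by simpa using PiLp.norm_apply_le x i
    have h3 := abs_le.1 (h2.trans (h1.trans (le_max_left R0 0)))
    constructor <;> linarith
  have hUbox : U ⊆ box n R := subset_union_left.trans hsub
  have hVbox : V ⊆ box n R := subset_union_right.trans hsub
  have hBm := measurableSet_box n hR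
  have hBf := volume_box_lt n hR
  have hUm := hUo.measurableSet
  -- the measures
  have hθm : Measurable (fun x => thetaFn U u c (u x)) :=
    (measurable_thetaFn hUo u c).comp hu.continuous.measurable
  set ν := (volume.restrict U).withDensity (fun x => thetaFn U u c (u x)) with hν
  set ρ := (volume.restrict U).withDensity (fun x => 1 - thetaFn U u c (u x)) with hρ
  have hνρ : ν + ρ = volume.restrict U := by
    rw [hν, hρ, ← withDensity_add_left hθm]
    have : ((fun x => thetaFn U u c (u x)) + fun x => 1 - thetaFn U u c (u x)) = 1 := by
      ext x
      simp only [Pi.add_apply, Pi.one_apply]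
      exact add_tsub_cancel_of_le (min_le_left _ _)
    rw [this, withDensity_one]
  have : IsFiniteMeasure (volume.restrict U) := ⟨by simpa using hUb.measure_lt_top⟩
  have : IsFiniteMeasure (volume.restrict V) := ⟨by simpa using hVb.measure_lt_top⟩
  have : IsFiniteMeasure (volume.restrict (box n R \ U)) :=
    ⟨by simpa using (measure_mono diff_subset).trans_lt hBf⟩
  have : IsFiniteMeasure (volume.restrict (box n R \ V)) :=
    ⟨by simpa using (measure_mono diff_subset).trans_lt hBf⟩
  have : IsFiniteMeasure ν := isFiniteMeasure_of_le (volume.restrict U) (hνρ ▸ Measure.le_add_right le_rfl)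
  have : IsFiniteMeasure ρ := isFiniteMeasure_of_le (volume.restrict U) (hνρ ▸ Measure.le_add_left le_rfl)
  have hle : ν.map T ≤ volume.restrict V := map_le hUo hu.continuous hae hκ
  set τ := volume.restrict V - ν.map T with hτ
  have hτν : τ + ν.map T = volume.restrict V := Measure.sub_add_cancel_of_le hle
  have : IsFiniteMeasure τ := isFiniteMeasure_of_le (volume.restrict V) Measure.sub_le
  have hmass : ρ univ = τ univ := by
    have h1 : ν univ + ρ univ = volume U := by
      rw [← Measure.add_apply, hνρ, Measure.restrict_apply_univ]
    have h2 : τ univ + ν univ = volume U := by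
      rw [← hVvol, ← Measure.restrict_apply_univ V, ← hτν, Measure.add_apply,
        Measure.map_apply hT.measurable MeasurableSet.univ, preimage_univ]
    rw [add_comm, ← h2] at h1
    exact (ENNReal.add_left_inj (measure_ne_top ν univ)).1 h1
  have hmass2 : (volume.restrict (box n R \ U)) univ = (volume.restrict (box n R \ V)) univ := by
    rw [Measure.restrict_apply_univ, Measure.restrict_apply_univ,
      measure_diff hUbox hUm.nullMeasurableSet hUfin,
      measure_diff hVbox hVm.nullMeasurableSet (by rw [hVvol]; exact hUfin), hVvol]
  have hgm : Measurable (fun x => (x, T x)) := measurable_id.prodMk hT.measurable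
  set γ := ν.map (fun x => (x, T x)) + avg ρ τ +
    avg (volume.restrict (box n R \ U)) (volume.restrict (box n R \ V)) with hγ
  have hU2 : volume.restrict U + volume.restrict (box n R \ U) = volume.restrict (box n R) := by
    rw [← Measure.restrict_union disjoint_sdiff_right (hBm.diff hUm), union_diff_cancel hUbox]
  have hV2 : volume.restrict V + volume.restrict (box n R \ V) = volume.restrict (box n R) := by
    rw [← Measure.restrict_union disjoint_sdiff_right (hBm.diff hVm), union_diff_cancel hVbox]
  have h1 : γ.map Prod.fst = volume.restrict (box n R) := by
    rw [hγ, Measure.map_add _ _ measurable_fst, Measure.map_add _ _ measurable_fst,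
      avg_fst _ _ hmass, avg_fst _ _ hmass2, Measure.map_map measurable_fst hgm, ← hU2, ← hνρ]
    congr 2
    exact Measure.map_id
  have h2 : γ.map Prod.snd = volume.restrict (box n R) := by
    rw [hγ, Measure.map_add _ _ measurable_snd, Measure.map_add _ _ measurable_snd,
      avg_snd _ _ hmass, avg_snd _ _ hmass2, Measure.map_map measurable_snd hgm, ← hV2, ← hτν,
      add_comm τ]
    rfl
  have hγf : IsFiniteMeasure γ := by
    constructor
    have : γ univ = γ.map Prod.fst univ := by
      rw [Measure.map_apply measurable_fst MeasurableSet.univ, preimage_univ]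
    rw [this, h1, Measure.restrict_apply_univ]
    exact hBf
  obtain ⟨Φ, C, hΦ1, hΦ2, hΦ3, hΦ4⟩ := realise hn hR γ h1 h2 U hUo hUbox hu hκ.le ε hε
  refine ⟨Φ, C, hΦ1, hΦ2, hΦ3, hΦ4.trans ?_⟩
  gcongr
  -- cost estimate
  have hcont : Continuous fun p : EE n × EE n => ENNReal.ofReal ‖u p.1 - κ • p.2‖ := by
    have := hu.continuous
    exact ENNReal.continuous_ofReal.comp (by fun_prop)
  have hUfst : MeasurableSet (Prod.fst ⁻¹' U : Set (EE n × EE n)) := measurable_fst hUm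
  rw [hγ, Measure.restrict_add, Measure.restrict_add, lintegral_add_measure, lintegral_add_measure]
  have c1 : ∫⁻ p in Prod.fst ⁻¹' U, ENNReal.ofReal ‖u p.1 - κ • p.2‖ ∂(ν.map fun x => (x, T x)) = 0 := by
    rw [← nonpos_iff_eq_zero]
    refine (setLIntegral_le_lintegral _ _).trans ?_
    rw [lintegral_map hcont.measurable hgm]
    simp [T, smul_smul, mul_inv_cancel₀ hκ.ne']
  have c3 : ∫⁻ p in Prod.fst ⁻¹' U, ENNReal.ofReal ‖u p.1 - κ • p.2‖
      ∂(avg (volume.restrict (box n R \ U)) (volume.restrict (box n R \ V))) = 0 := by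
    rw [Measure.restrict_eq_zero.2, lintegral_zero_measure]
    rw [← Measure.map_apply measurable_fst hUm, avg_fst _ _ hmass2, Measure.restrict_apply hUm]
    simp
  rw [c1, c3, zero_add, add_zero]
  have hρ1 : ρ univ = ∫⁻ x in U, (1 - thetaFn U u c (u x)) := by
    rw [hρ, withDensity_apply _ MeasurableSet.univ, Measure.restrict_univ]
  rw [← hρ1]
  have hρU : ∀ᵐ x ∂ρ, x ∈ U :=
    (Measure.absolutelyContinuous_of_le (hνρ ▸ Measure.le_add_left le_rfl :
      ρ ≤ volume.restrict U)).ae_le (ae_restrict_mem hUm)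
  have hτV : ∀ᵐ x ∂τ, x ∈ V :=
    (Measure.absolutelyContinuous_of_le Measure.sub_le).ae_le (ae_restrict_mem hVm)
  calc _ ≤ ∫⁻ p, ENNReal.ofReal ‖u p.1 - κ • p.2‖ ∂(avg ρ τ) := setLIntegral_le_lintegral _ _
    _ ≤ ∫⁻ p, ENNReal.ofReal d ∂(avg ρ τ) := by
        refine lintegral_mono_ae ?_
        have a1 : ∀ᵐ p ∂(avg ρ τ), p.1 ∈ U := by
          have : ∀ᵐ x ∂((avg ρ τ).map Prod.fst), x ∈ U := by rwa [avg_fst _ _ hmass]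
          exact ae_of_ae_map measurable_fst.aemeasurable this
        have a2 : ∀ᵐ p ∂(avg ρ τ), p.2 ∈ V := by
          have : ∀ᵐ x ∂((avg ρ τ).map Prod.snd), x ∈ V := by rwa [avg_snd _ _ hmass]
          exact ae_of_ae_map measurable_snd.aemeasurable this
        filter_upwards [a1, a2] with p hp1 hp2
        obtain ⟨z, hz, hz2⟩ := hp2
        apply ENNReal.ofReal_le_ofReal
        rw [← hz2]
        simp only [T, smul_smul, mul_inv_cancel₀ hκ.ne', one_smul]
        rw [← dist_eq_norm]
        exact (dist_le_diam_of_mem hub (mem_image_of_mem _ hp1) (mem_image_of_mem _ hz)).trans hd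
    _ = ENNReal.ofReal d * ρ univ := by
        rw [lintegral_const]
        congr 1
        conv_rhs => rw [← avg_fst ρ τ hmass]
        rw [Measure.map_apply measurable_fst MeasurableSet.univ, preimage_univ]

end

lemma oneD {J : Set ℝ} (hJc : J.OrdConnected) (hJm : MeasurableSet J) (hJf : volume J ≠ ⊤)
    {g : ℝ → ℝ} {K : NNReal} (hg : LipschitzWith K g) {lam : ℝ} (hlam : 0 < lam)
    (hd : ∀ᵐ t ∂(volume.restrict J), lam ≤ deriv g t) (c : ℝ) :
    InjOn g J ∧ ∀ x ∈ J, ∀ y ∈ J, |g y - g x - c * (y - x)| ≤ ∫ t in J, |c - deriv g t| := by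
  have hftc : ∀ x y, ∫ t in x..y, deriv g t = g y - g x := fun x y =>
    (hg.lipschitzOnWith.absolutelyContinuousOnInterval).integral_deriv_eq_sub
  have hii : ∀ x y, IntervalIntegrable (deriv g) volume x y := fun x y =>
    (hg.lipschitzOnWith.absolutelyContinuousOnInterval).intervalIntegrable_deriv
  have hfin : IsFiniteMeasure (volume.restrict J) := ⟨by simpa using hJf.lt_top⟩
  have hint : IntegrableOn (fun t => |c - deriv g t|) J := by
    refine Integrable.abs (Integrable.sub (integrable_const c) ?_)
    refine Integrable.of_bound (measurable_deriv g).aestronglyMeasurable K ?_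
    exact Filter.Eventually.of_forall fun t => norm_deriv_le_of_lipschitz hg
  have hsub : ∀ x ∈ J, ∀ y ∈ J, x ≤ y → Ioc x y ⊆ J := fun x hx y hy _ =>
    Ioc_subset_Icc_self.trans (hJc.out hx hy)
  have hmono : ∀ x ∈ J, ∀ y ∈ J, x ≤ y → lam * (y - x) ≤ g y - g x := by
    intro x hx y hy hxy
    rw [← hftc]
    have h1 : lam * (y - x) = ∫ t in x..y, lam := by
      rw [intervalIntegral.integral_const, smul_eq_mul, mul_comm]
    rw [h1]
    refine intervalIntegral.integral_mono_ae_restrict hxy intervalIntegrable_const (hii x y) ?_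
    refine ae_restrict_of_ae_restrict_of_subset ?_ hd |> fun h => h
    exact hJc.out hx hy
  constructor
  · intro x hx y hy hxy
    rcases le_total x y with h | h
    · have := hmono x hx y hy h
      rw [hxy, sub_self] at this
      nlinarith
    · have := hmono y hy x hx h
      rw [hxy, sub_self] at this
      nlinarith
  · have key : ∀ x ∈ J, ∀ y ∈ J, x ≤ y →
        |g y - g x - c * (y - x)| ≤ ∫ t in J, |c - deriv g t| := by
      intro x hx y hy hxy
      have e : g y - g x - c * (y - x) = - ∫ t in x..y, (c - deriv g t) := by
        rw [intervalIntegral.integral_sub intervalIntegrable_const (hii x y), hftc,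
          intervalIntegral.integral_const, smul_eq_mul]
        ring
      rw [e, abs_neg]
      refine (intervalIntegral.abs_integral_le_integral_abs hxy).trans ?_
      rw [intervalIntegral.integral_of_le hxy]
      refine setIntegral_mono_set hint ?_ (hsub x hx y hy hxy).eventuallyLE
      exact Filter.Eventually.of_forall fun t => abs_nonneg _
    intro x hx y hy
    rcases le_total x y with h | h
    · exact key x hx y hy h
    · have := key y hy x hx h
      rw [← abs_neg]
      convert this using 2
      ring

def e1 : ℝ ≃ₗᵢ[ℝ] EE 1 := (OrthonormalBasis.singleton (Fin 1) ℝ).repr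

lemma e1_mp : MeasurePreserving e1 volume volume :=
  (OrthonormalBasis.singleton (Fin 1) ℝ).measurePreserving_repr

lemma detD_one (u : EE 1 → EE 1) {t : ℝ} (h : DifferentiableAt ℝ u (e1 t)) :
    deriv (fun t => e1.symm (u (e1 t))) t = detD u (e1 t) := by
  have h1 : HasFDerivAt (fun t => e1.symm (u (e1 t)))
      ((e1.symm.toContinuousLinearEquiv : EE 1 →L[ℝ] ℝ).comp ((fderiv ℝ u (e1 t)).comp
        (e1.toContinuousLinearEquiv : ℝ →L[ℝ] EE 1))) t := by
    have a := (e1.toContinuousLinearEquiv : ℝ →L[ℝ] EE 1).hasFDerivAt (x := t)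
    have b := (e1.symm.toContinuousLinearEquiv : EE 1 →L[ℝ] ℝ).hasFDerivAt (x := u (e1 t))
    exact b.comp t (h.hasFDerivAt.comp t a)
  rw [h1.hasDerivAt.deriv, detD, ← LinearMap.det_conj _ e1.symm.toLinearEquiv, LinearMap.det_ring]
  rfl

theorem case_one {U : Set (EE 1)} (hUo : IsOpen U) (hUc : IsConnected U) (hUf : volume U ≠ ⊤)
    {u : EE 1 → EE 1} {K : NNReal} (hu : LipschitzWith K u) {lam : ℝ} (hlam : 0 < lam)
    (hdet : ∀ᵐ x ∂(volume.restrict U), DifferentiableAt ℝ u x ∧ lam ≤ detD u x) (c : ℝ) :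
    ∀ x ∈ U, ∀ y ∈ U, ‖u y - u x - c • (y - x)‖ ≤
      ∫ x in U, |c - ((omegaFn U u (u x))⁻¹).toReal| := by
  have hemb : MeasurableEmbedding (e1 : ℝ → EE 1) := e1.toHomeomorph.measurableEmbedding
  set J := e1 ⁻¹' U with hJ
  have hJo : IsOpen J := hUo.preimage e1.continuous
  have hJc : J.OrdConnected := by
    have : J = e1.symm '' U := by
      ext t; constructor
      · intro h; exact ⟨e1 t, h, by simp⟩
      · rintro ⟨x, hx, rfl⟩; simpa [hJ] using hx
    rw [this]
    exact (hUc.isPreconnected.image _ e1.symm.continuous.continuousOn).ordConnected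
  have hmpJ : MeasurePreserving e1 (volume.restrict J) (volume.restrict U) :=
    e1_mp.restrict_preimage_emb hemb U
  have hJf : volume J ≠ ⊤ := by
    rw [hJ, e1_mp.measure_preimage_emb hemb]; exact hUf
  set g : ℝ → ℝ := fun t => e1.symm (u (e1 t)) with hgdef
  have hg : LipschitzWith K g := by
    have := (e1.symm.lipschitz.comp hu).comp e1.lipschitz
    rw [one_mul, mul_one] at this
    exact this
  have hd : ∀ᵐ t ∂(volume.restrict J), DifferentiableAt ℝ u (e1 t) ∧ lam ≤ detD u (e1 t) :=
    hmpJ.quasiMeasurePreserving.ae hdet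
  have hd' : ∀ᵐ t ∂(volume.restrict J), lam ≤ deriv g t := by
    filter_upwards [hd] with t ht
    rw [hgdef, detD_one u ht.1]; exact ht.2
  obtain ⟨hinj, hest⟩ := oneD hJc hJo.measurableSet hJf hg hlam hd' c
  have hinjU : InjOn u U := by
    intro x hx y hy hxy
    have : e1.symm x = e1.symm y := by
      apply hinj
      · simpa [hJ] using hx
      · simpa [hJ] using hy
      · simp [hgdef, hxy]
    exact e1.symm.injective this
  have hI : ∫ x in U, |c - ((omegaFn U u (u x))⁻¹).toReal| = ∫ t in J, |c - deriv g t| := by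
    rw [← hmpJ.integral_comp hemb]
    refine integral_congr_ae ?_
    filter_upwards [hd, ae_restrict_mem hJo.measurableSet] with t ht htJ
    have hpos : 0 < detD u (e1 t) := hlam.trans_le ht.2
    have hω : omegaFn U u (u (e1 t)) = ENNReal.ofReal (detD u (e1 t))⁻¹ := by
      unfold omegaFn
      rw [tsum_eq_single ⟨e1 t, htJ, rfl, ht.1, hpos⟩]
      rintro ⟨z, hz1, hz2, hz3⟩ hne
      exact absurd (Subtype.ext (hinjU hz1 htJ hz2)) hne
    rw [hω, hgdef, detD_one u ht.1, ENNReal.toReal_inv, ENNReal.toReal_ofReal (by positivity),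
      inv_inv]
  intro x hx y hy
  rw [hI]
  have := hest (e1.symm x) (by simpa [hJ] using hx) (e1.symm y) (by simpa [hJ] using hy)
  refine le_trans (le_of_eq ?_) this
  rw [← e1.symm.norm_map]
  simp [hgdef]

lemma detD_congr {n : ℕ} {U : Set (EE n)} (hUo : IsOpen U) {u v : EE n → EE n} (h : EqOn u v U)
    {x : EE n} (hx : x ∈ U) :
    (DifferentiableAt ℝ u x ↔ DifferentiableAt ℝ v x) ∧ detD u x = detD v x := by
  have he : u =ᶠ[nhds x] v := h.eventuallyEq_of_mem (hUo.mem_nhds hx)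
  refine ⟨he.differentiableAt_iff, ?_⟩
  rw [detD, detD, he.fderiv_eq]

lemma omegaFn_congr {n : ℕ} {U : Set (EE n)} (hUo : IsOpen U) {u v : EE n → EE n} (h : EqOn u v U)
    (y : EE n) : omegaFn U u y = omegaFn U v y := by
  have e : ∀ w : EE n → EE n, omegaFn U w y =
      ∑' x, ({x | x ∈ U ∧ w x = y ∧ DifferentiableAt ℝ w x ∧ 0 < detD w x}).indicator
        (fun x => ENNReal.ofReal (detD w x)⁻¹) x := by
    intro w
    rw [← tsum_subtype]; rfl
  rw [e, e]
  congr 1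
  ext x
  by_cases hx : x ∈ U
  · obtain ⟨h1, h2⟩ := detD_congr hUo h hx
    have hiff : x ∈ {x | x ∈ U ∧ u x = y ∧ DifferentiableAt ℝ u x ∧ 0 < detD u x} ↔
        x ∈ {x | x ∈ U ∧ v x = y ∧ DifferentiableAt ℝ v x ∧ 0 < detD v x} := by
      simp only [mem_ofPred_eq]
      rw [h1, h2, h hx]
    by_cases hm : x ∈ {x | x ∈ U ∧ v x = y ∧ DifferentiableAt ℝ v x ∧ 0 < detD v x}
    · rw [indicator_of_mem hm, indicator_of_mem (hiff.2 hm), h2]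
    · rw [indicator_of_notMem hm, indicator_of_notMem (fun h => hm (hiff.1 h))]
  · simp [indicator, hx]

lemma map_inj_restrict {n : ℕ} {Φ : EE n → EE n} (hc : Continuous Φ)
    (hmp : MeasurePreserving Φ volume volume) (hi : Function.Injective Φ) {U : Set (EE n)}
    (hU : MeasurableSet U) :
    ∃ B : Set (EE n), MeasurableSet B ∧ Measure.map Φ (volume.restrict U) = volume.restrict B := by
  have hemb := hc.measurableEmbedding hi
  exact ⟨Φ '' U, hemb.measurableSet_image' hU, (hmp.restrict_image_emb hemb U).map_eq⟩

theorem main_lip (n : ℕ) (hn : 1 ≤ n)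
    (U : Set (EE n)) (hne : U.Nonempty) (hUo : IsOpen U)
    (hUb : IsBounded U) (hUc : IsConnected U)
    (u : EE n → EE n) (K : NNReal)
    (hu : LipschitzWith K u) (hub : IsBounded (u '' U))
    (d : ℝ) (m : ℕ) (lam : ℝ)
    (hd : diam (u '' U) ≤ d)
    (hm : essSup (fun y => (U ∩ u ⁻¹' {y}).encard) volume ≤ (m : ℕ∞))
    (hlam : 0 < lam)
    (hdet : ∀ᵐ x ∂(volume.restrict U), DifferentiableAt ℝ u x ∧ lam ≤ detD u x) :
    ∃ (s : EE n → EE n) (Ks : NNReal),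
      LipschitzOnWith Ks s U ∧ IsBounded (s '' U) ∧
      (∃ B : Set (EE n), MeasurableSet B ∧
        Measure.map s (volume.restrict U) = volume.restrict B) ∧
      (∫ x in U,
          ‖u x - (((volume (u '' U)).toReal / (volume U).toReal) ^ ((n : ℝ))⁻¹) • s x‖)
        ≤ 5 * ((m : ℝ) * d / lam) *
          ∫ x in U, |(volume (u '' U)).toReal / (volume U).toReal -
            ((omegaFn U u (u x))⁻¹).toReal| := by
  have hUm := hUo.measurableSet
  have hae := ae_Gset hlam hdet hUo
  have hU0 : volume U ≠ 0 := (hUo.measure_pos volume hne).ne'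
  have hUt : volume U ≠ ⊤ := hUb.measure_lt_top.ne
  have hle := volume_le hu hlam hdet hUo hm
  have hA0 : volume (u '' U) ≠ 0 := by
    intro h; rw [h, mul_zero] at hle; exact hU0 (le_antisymm hle zero_le)
  have hAt : volume (u '' U) ≠ ⊤ := hub.measure_lt_top.ne
  set a := (volume (u '' U)).toReal with ha
  set b := (volume U).toReal with hb
  have ha0 : 0 < a := ENNReal.toReal_pos hA0 hAt
  have hb0 : 0 < b := ENNReal.toReal_pos hU0 hUt
  have hba : b ≤ m / lam * a := by
    have := ENNReal.toReal_mono (ENNReal.mul_ne_top ENNReal.ofReal_ne_top hAt) hle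
    rwa [ENNReal.toReal_mul, ENNReal.toReal_ofReal (by positivity)] at this
  set q : ℝ := m / lam with hq
  have hq0 : 0 < q := by
    by_contra h
    have := mul_nonpos_of_nonpos_of_nonneg (not_lt.1 h) ha0.le
    linarith
  set c := a / b with hc
  have hc0 : 0 < c := div_pos ha0 hb0
  have hcq : 1 / c ≤ q := by
    rw [hc, one_div_div, div_le_iff₀ ha0]; exact hba
  set κ := c ^ ((n : ℝ))⁻¹ with hκ
  have hκ0 : 0 < κ := Real.rpow_pos_of_pos hc0 _
  have hκn : κ ^ n = c := Real.rpow_inv_natCast_pow hc0.le (by omega)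
  set I := ∫ x in U, |c - ((omegaFn U u (u x))⁻¹).toReal| with hI
  have hI0 : 0 ≤ I := integral_nonneg fun x => abs_nonneg _
  have hd0 : 0 < d := by
    refine lt_of_lt_of_le ?_ hd
    rcases (diam_nonneg (s := u '' U)).lt_or_eq with h | h
    · exact h
    · exfalso
      have hs : (u '' U).Subsingleton := by
        intro x hx y hy
        have := dist_le_diam_of_mem hub hx hy
        rw [← h] at this
        exact dist_le_zero.1 this
      have : Nonempty (Fin n) := ⟨⟨0, by omega⟩⟩
      exact hA0 (hs.measure_zero volume)
  have hfin : IsFiniteMeasure (volume.restrict U) := ⟨by simpa using hUb.measure_lt_top⟩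
  rw [show 5 * ((m : ℝ) * d / lam) * I = 5 * (q * d * I) by rw [hq]; ring]
  by_cases hn1 : n = 1
  · subst hn1
    obtain ⟨x0, hx0⟩ := hne
    have hκc : κ = c := by rw [← hκn, pow_one]
    have hest := case_one hUo hUc hUt hu hlam hdet c x0 hx0
    set v : EE 1 := c⁻¹ • u x0 - x0 with hv
    have hlip : LipschitzWith 1 (fun x : EE 1 => x + v) := (isometry_add_right v).lipschitz
    refine ⟨fun x => x + v, 1, hlip.lipschitzOnWith, ?_, ?_, ?_⟩
    · exact hlip.isBounded_image hUb
    · exact map_inj_restrict (by fun_prop) (measurePreserving_add_right volume v)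
        (add_left_injective v) hUm
    · have h1 : ∀ x ∈ U, ‖‖u x - κ • (x + v)‖‖ ≤ I := by
        intro x hx
        rw [norm_norm]
        refine le_trans (le_of_eq ?_) (hest x hx)
        congr 1
        rw [hκc, hv, smul_add, smul_sub, smul_sub, smul_smul, mul_inv_cancel₀ hc0.ne', one_smul]
        abel
      have h2 := norm_setIntegral_le_of_norm_le_const (μ := volume) hUb.measure_lt_top h1
      have h3 : a ≤ d := by
        have hemb : MeasurableEmbedding (e1 : ℝ → EE 1) := e1.toHomeomorph.measurableEmbedding
        have h4 : volume (u '' U) ≤ ENNReal.ofReal d := by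
          rw [← e1_mp.measure_preimage_emb hemb]
          refine (Real.volume_le_diam _).trans ?_
          refine ediam_le fun x hx y hy => ?_
          rw [edist_dist]
          apply ENNReal.ofReal_le_ofReal
          rw [← e1.dist_map]
          exact (dist_le_diam_of_mem hub hx hy).trans hd
        rw [ha]
        exact ENNReal.toReal_le_of_le_ofReal hd0.le h4
      have h5 : b ≤ q * d := hba.trans (by gcongr)
      have h6 : I * b ≤ I * (q * d) := by gcongr
      have h7 : 0 ≤ I * (q * d) := by positivity
      calc _ ≤ I * b := (le_abs_self _).trans h2
        _ ≤ 5 * (q * d * I) := by linarith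
  have hn2 : 2 ≤ n := by omega
  have hωm : Measurable (fun x => (omegaFn U u (u x))⁻¹) :=
    ((measurable_omegaFn hUo u).comp hu.continuous.measurable).inv
  have hint : Integrable (fun x => |c - ((omegaFn U u (u x))⁻¹).toReal|) (volume.restrict U) := by
    refine Integrable.abs (Integrable.sub (integrable_const c) ?_)
    refine integrable_toReal_of_lintegral_ne_top hωm.aemeasurable ?_
    rw [lintegral_inv_omega hu hlam hdet hUo hm]; exact hAt
  have hIE : ENNReal.ofReal I = ∫⁻ x in U, ENNReal.ofReal |c - ((omegaFn U u (u x))⁻¹).toReal| :=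
    ofReal_integral_eq_lintegral_ofReal hint (Filter.Eventually.of_forall fun x => abs_nonneg _)
  set cE := ENNReal.ofReal (κ ^ n) with hcE
  have hcE' : cE = ENNReal.ofReal c := by rw [hcE, hκn]
  have hcE0 : cE ≠ 0 := by rw [hcE']; simpa using hc0
  have hcEt : cE ≠ ⊤ := ENNReal.ofReal_ne_top
  have hcEr : cE.toReal = c := by rw [hcE', ENNReal.toReal_ofReal hc0.le]
  have hvol : volume (u '' U) = cE * volume U := by
    rw [← ENNReal.ofReal_toReal hAt, ← ENNReal.ofReal_toReal hUt, hcE', ← ENNReal.ofReal_mul hc0.le,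
      ← ha, ← hb, hc, div_mul_cancel₀ _ hb0.ne']
  have hθm : Measurable (fun x => thetaFn U u cE (u x)) :=
    (measurable_thetaFn hUo u cE).comp hu.continuous.measurable
  have hθ1 : Measurable (fun x => 1 - thetaFn U u cE (u x)) := measurable_const.sub hθm
  set r := ∫⁻ x in U, (1 - thetaFn U u cE (u x)) with hr
  have hcr : cE * r ≤ ENNReal.ofReal I := by
    rw [hr, ← lintegral_const_mul _ hθ1, hIE]
    refine lintegral_mono_ae ?_
    filter_upwards [hae] with x hx
    have := theta_bound hcE0 hcEt (omegaFn_pos hx).ne'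
    rwa [hcEr] at this
  have hlhs : ∀ s : EE n → EE n, Continuous s → ∀ A : ℝ, 0 ≤ A →
      ∫⁻ x in U, ENNReal.ofReal ‖u x - κ • s x‖ ≤ ENNReal.ofReal A →
      ∫ x in U, ‖u x - κ • s x‖ ≤ A := by
    intro s hs A hA h
    have := hu.continuous
    rw [integral_eq_lintegral_of_nonneg_ae (Filter.Eventually.of_forall fun x => norm_nonneg _)
      (by fun_prop : Continuous fun x => ‖u x - κ • s x‖).aestronglyMeasurable]
    exact ENNReal.toReal_le_of_le_ofReal hA h
  by_cases hr0 : r = 0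
  · have hTc : Continuous (fun x => κ⁻¹ • u x) := by have := hu.continuous; fun_prop
    have hlipT : LipschitzWith (‖κ⁻¹‖₊ * K) (fun x => κ⁻¹ • u x) :=
      (lipschitzWith_smul κ⁻¹).comp hu
    refine ⟨fun x => κ⁻¹ • u x, ‖κ⁻¹‖₊ * K, hlipT.lipschitzOnWith, hlipT.isBounded_image hUb,
      ⟨(fun x => κ⁻¹ • u x) '' U, measurableSet_image hTc hUo, ?_⟩, ?_⟩
    · have h1 := map_le hUo hu.continuous hae hκ0
      have h2 : (volume.restrict U).withDensity (fun x => thetaFn U u cE (u x))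
          = volume.restrict U := by
        have : (fun x => thetaFn U u cE (u x)) =ᵐ[volume.restrict U] 1 := by
          rw [hr, lintegral_eq_zero_iff hθ1] at hr0
          filter_upwards [hr0] with x hx
          exact le_antisymm (min_le_left _ _) (tsub_eq_zero_iff_le.1 hx)
        rw [withDensity_congr_ae this, withDensity_one]
      rw [← hcE, h2] at h1
      have := hfin
      refine Measure.eq_of_le_of_measure_univ_eq h1 ?_
      rw [Measure.map_apply hTc.measurable MeasurableSet.univ, preimage_univ,
        Measure.restrict_apply_univ, Measure.restrict_apply_univ]
      have h3 := volume_smul_inter hκ0 (u '' U) univ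
      rw [inter_univ, preimage_univ, inter_univ, image_image, hvol, ← hcE, ← mul_assoc,
        ENNReal.inv_mul_cancel hcE0 hcEt, one_mul] at h3
      exact h3.symm
    · simp only [smul_smul, mul_inv_cancel₀ hκ0.ne', one_smul, sub_self, norm_zero,
        integral_zero]
      positivity
  · have hIpos : 0 < I := by
      have : 0 < cE * r := pos_iff_ne_zero.2 (mul_ne_zero hcE0 hr0)
      exact ENNReal.ofReal_pos.1 (this.trans_le hcr)
    have hqdI : 0 < q * d * I := by positivity
    obtain ⟨Φ, C, hΦ1, hΦ2, hΦ3, hΦ4⟩ := coupling hn2 hUo hUb hu hub hd hae hκ0 hvol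
      (ENNReal.ofReal (q * d * I)) (ENNReal.ofReal_pos.2 hqdI)
    refine ⟨Φ, C, hΦ1.lipschitzOnWith, hΦ1.isBounded_image hUb,
      map_inj_restrict hΦ1.continuous hΦ2 hΦ3 hUm, ?_⟩
    refine hlhs Φ hΦ1.continuous _ (by positivity) (hΦ4.trans ?_)
    have hrI : r ≤ ENNReal.ofReal (q * I) := by
      calc r = cE⁻¹ * (cE * r) := by
            rw [← mul_assoc, ENNReal.inv_mul_cancel hcE0 hcEt, one_mul]
        _ ≤ ENNReal.ofReal (1 / c) * ENNReal.ofReal I := by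
            rw [hcE', one_div, ENNReal.ofReal_inv_of_pos hc0, ← hcE']
            gcongr
        _ ≤ ENNReal.ofReal q * ENNReal.ofReal I := by
            gcongr
        _ = _ := (ENNReal.ofReal_mul hq0.le).symm
    calc _ ≤ ENNReal.ofReal d * ENNReal.ofReal (q * I) + ENNReal.ofReal (q * d * I) := by
          gcongr
      _ = ENNReal.ofReal (d * (q * I) + q * d * I) := by
          rw [← ENNReal.ofReal_mul hd0.le, ← ENNReal.ofReal_add (by positivity) hqdI.le]
      _ ≤ _ := ENNReal.ofReal_le_ofReal (by nlinarith)

theorem stmt_4 (n : ℕ) (hn : 1 ≤ n)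
    (U : Set (EuclideanSpace ℝ (Fin n))) (hne : U.Nonempty) (hUo : IsOpen U)
    (hUb : IsBounded U) (hUc : IsConnected U)
    (u : EuclideanSpace ℝ (Fin n) → EuclideanSpace ℝ (Fin n)) (K : NNReal)
    (hu : LipschitzOnWith K u U) (hub : IsBounded (u '' U))
    (d : ℝ) (m : ℕ) (lam : ℝ)
    (hd : diam (u '' U) ≤ d)
    (hm : essSup (fun y => (U ∩ u ⁻¹' {y}).encard) volume ≤ (m : ℕ∞))
    (hlam : 0 < lam)
    (hdet : ∀ᵐ x ∂(volume.restrict U), DifferentiableAt ℝ u x ∧ lam ≤ detD u x) :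
    ∃ (s : EuclideanSpace ℝ (Fin n) → EuclideanSpace ℝ (Fin n)) (Ks : NNReal),
      LipschitzOnWith Ks s U ∧ IsBounded (s '' U) ∧
      (∃ B : Set (EuclideanSpace ℝ (Fin n)), MeasurableSet B ∧
        Measure.map s (volume.restrict U) = volume.restrict B) ∧
      (∫ x in U,
          ‖u x - (((volume (u '' U)).toReal / (volume U).toReal) ^ ((n : ℝ))⁻¹) • s x‖)
        ≤ 5 * ((m : ℝ) * d / lam) *
          ∫ x in U, |(volume (u '' U)).toReal / (volume U).toReal -
            ((omegaFn U u (u x))⁻¹).toReal| := by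
  obtain ⟨v, hv, huv⟩ := hu.extend_finite_dimension
  have him : u '' U = v '' U := huv.image_eq
  have hpre : (fun y => (U ∩ u ⁻¹' {y}).encard) = fun y => (U ∩ v ⁻¹' {y}).encard := by
    ext1 y
    congr 1
    ext x
    simp only [mem_inter_iff, mem_preimage, mem_singleton_iff]
    constructor
    · rintro ⟨h1, h2⟩; exact ⟨h1, by rw [← huv h1]; exact h2⟩
    · rintro ⟨h1, h2⟩; exact ⟨h1, by rw [huv h1]; exact h2⟩
  have hdet' : ∀ᵐ x ∂(volume.restrict U), DifferentiableAt ℝ v x ∧ lam ≤ detD v x := by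
    filter_upwards [hdet, ae_restrict_mem hUo.measurableSet] with x hx hxU
    obtain ⟨h1, h2⟩ := detD_congr hUo huv hxU
    exact ⟨h1.1 hx.1, h2 ▸ hx.2⟩
  obtain ⟨s, Ks, h1, h2, h3, h4⟩ := main_lip n hn U hne hUo hUb hUc v _ hv (him ▸ hub) d m lam
    (him ▸ hd) (hpre ▸ hm) hlam hdet'
  refine ⟨s, Ks, h1, h2, h3, ?_⟩
  rw [him]
  have e1 : ∫ x in U, ‖u x - (((volume (v '' U)).toReal / (volume U).toReal) ^ ((n : ℝ))⁻¹) • s x‖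
      = ∫ x in U, ‖v x - (((volume (v '' U)).toReal / (volume U).toReal) ^ ((n : ℝ))⁻¹) • s x‖ :=
    setIntegral_congr_fun hUo.measurableSet fun x hx => by simp only [huv hx]
  have e2 : ∫ x in U, |(volume (v '' U)).toReal / (volume U).toReal -
            ((omegaFn U u (u x))⁻¹).toReal| = ∫ x in U, |(volume (v '' U)).toReal / (volume U).toReal -
            ((omegaFn U v (v x))⁻¹).toReal| :=
    setIntegral_congr_fun hUo.measurableSet fun x hx => by
      simp only [huv hx, omegaFn_congr hUo huv]
  rw [e1, e2]
  exact h4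

end
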